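/- For every integer r ≥ 1 and every σ ≥ 1 there is a constant C > 0 depending only on r and σ such that: for every σ-quasi-uniform rectangular partition P of Ω with mesh size h, every bounded measurable α : Ω → ℝ, every u : Ω → ℝ that is continuous, vanishes on ∂Ω, and is C^{r+2} on each closed cell, and every test function w, the Lobatto interpolant u_I satisfies |a_P(u − u_I, w)| ≤ C · (sup |α|) · h^{r+1} · |u|_{r+2,P} · |w|_{P'}. -/

import Mathlib

open Polynomial MeasureTheory

noncomputable section

/-- `Leg r` is the `r`-th (formal) derivative of `(X² − 1)^r`, a nonzero scalar
multiple of the degree-`r` Legendre polynomial. -/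
def Leg (r : ℕ) : Polynomial ℝ :=
  (fun p => Polynomial.derivative p)^[r] ((Polynomial.X ^ 2 - 1) ^ r)

/-- `G 1 < … < G r` are the Gauss points: the roots of `Leg r`, all in `(-1,1)`. -/
def IsGaussPoints (r : ℕ) (G : ℕ → ℝ) : Prop :=
  (∀ k, 1 ≤ k → k < r → G k < G (k + 1)) ∧
  ∀ k, 1 ≤ k → k ≤ r → G k ∈ Set.Ioo (-1 : ℝ) 1 ∧ (Leg r).IsRoot (G k)

/-- `A k = ∫_{-1}^{1} ℓ_k` where `ℓ_k` is the Lagrange basis polynomial of degree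
`≤ r - 1` at the Gauss points, i.e. `ℓ_k (G j) = δ_{jk}`. -/
def IsGaussWeights (r : ℕ) (G A : ℕ → ℝ) : Prop :=
  ∀ k, 1 ≤ k → k ≤ r → ∃ ℓ : Polynomial ℝ,
    ℓ.natDegree ≤ r - 1 ∧
    (∀ j, 1 ≤ j → j ≤ r → ℓ.eval (G j) = if j = k then 1 else 0) ∧
    A k = ∫ x in (-1 : ℝ)..1, ℓ.eval x

/-- `Lob 0 = −1 < Lob 1 < … < Lob (r−1) < Lob r = 1` are the Lobatto points:
`±1` together with the roots of the derivative of `Leg r`. -/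
def IsLobattoPoints (r : ℕ) (L : ℕ → ℝ) : Prop :=
  L 0 = -1 ∧ L r = 1 ∧ (∀ k < r, L k < L (k + 1)) ∧
  ∀ k, 1 ≤ k → k + 1 ≤ r → L k ∈ Set.Ioo (-1 : ℝ) 1 ∧
    (Polynomial.derivative (Leg r)).IsRoot (L k)

/-- Cellwise partial derivative in the first (`x`) coordinate. -/
def pdx (f : ℝ × ℝ → ℝ) (z : ℝ × ℝ) : ℝ := fderiv ℝ f z (1, 0)

/-- Cellwise partial derivative in the second (`y`) coordinate. -/
def pdy (f : ℝ × ℝ → ℝ) (z : ℝ × ℝ) : ℝ := fderiv ℝ f z (0, 1)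

/-- A rectangular partition of `Ω = [a,b] × [c,d]`:
`a = x₀ < x₁ < … < x_m = b`, `c = y₀ < y₁ < … < y_n = d`. -/
structure RectPartition (a b c d : ℝ) where
  m : ℕ
  n : ℕ
  hm : 0 < m
  hn : 0 < n
  x : ℕ → ℝ
  y : ℕ → ℝ
  hxa : x 0 = a
  hxb : x m = b
  hyc : y 0 = c
  hyd : y n = d
  hxlt : ∀ i < m, x i < x (i + 1)
  hylt : ∀ j < n, y j < y (j + 1)

namespace RectPartition

variable {a b c d : ℝ}

/-- The domain `Ω = [a,b] × [c,d]`. -/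
def dom (_P : RectPartition a b c d) : Set (ℝ × ℝ) := Set.Icc a b ×ˢ Set.Icc c d

/-- The boundary `∂Ω`. -/
def bdry (P : RectPartition a b c d) : Set (ℝ × ℝ) :=
  P.dom \ (Set.Ioo a b ×ˢ Set.Ioo c d)

variable (P : RectPartition a b c d)

/-- Side length `h_i^x = x_i − x_{i−1}`. -/
def hx (i : ℕ) : ℝ := P.x i - P.x (i - 1)

/-- Side length `h_j^y = y_j − y_{j−1}`. -/
def hy (j : ℕ) : ℝ := P.y j - P.y (j - 1)

/-- The closed cell `τ_{i,j} = [x_{i−1}, x_i] × [y_{j−1}, y_j]`. -/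
def cell (i j : ℕ) : Set (ℝ × ℝ) :=
  Set.Icc (P.x (i - 1)) (P.x i) ×ˢ Set.Icc (P.y (j - 1)) (P.y j)

/-- The open cell `(x_{i−1}, x_i) × (y_{j−1}, y_j)`. -/
def openCell (i j : ℕ) : Set (ℝ × ℝ) :=
  Set.Ioo (P.x (i - 1)) (P.x i) ×ˢ Set.Ioo (P.y (j - 1)) (P.y j)

/-- The finite set of all side lengths of the partition. -/
def sides : Finset ℝ := ((Finset.Icc 1 P.m).image P.hx) ∪ ((Finset.Icc 1 P.n).image P.hy)

lemma sides_nonempty : P.sides.Nonempty :=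
  ⟨P.hx 1, Finset.mem_union_left _
    (Finset.mem_image_of_mem _ (Finset.mem_Icc.mpr ⟨le_rfl, P.hm⟩))⟩

/-- The mesh size `h`: the largest side length. -/
def meshSize : ℝ := P.sides.max' P.sides_nonempty

/-- `σ`-quasi-uniformity: every side length is at most `σ` times any other,
i.e. `h ≤ σ · min side`. -/
def QuasiUniform (σ : ℝ) : Prop := ∀ s ∈ P.sides, ∀ t ∈ P.sides, s ≤ σ * t

variable (r : ℕ) (G : ℕ → ℝ)

/-- The Gauss point `g^x_{i,k} = (x_i + x_{i−1} + h_i^x G_k)/2` for `1 ≤ k ≤ r`,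
with the conventions `g^x_{i,r+1} = g^x_{i+1,1}` (for `i < m`) and `g^x_{m,r+1} = b`. -/
def gx (i k : ℕ) : ℝ :=
  if k = r + 1 then
    (if i = P.m then P.x P.m
     else (P.x (i + 1) + P.x i + P.hx (i + 1) * G 1) / 2)
  else (P.x i + P.x (i - 1) + P.hx i * G k) / 2

/-- The Gauss point `g^y_{j,l}`, with the analogous conventions. -/
def gy (j l : ℕ) : ℝ :=
  if l = r + 1 then
    (if j = P.n then P.y P.n
     else (P.y (j + 1) + P.y j + P.hy (j + 1) * G 1) / 2)
  else (P.y j + P.y (j - 1) + P.hy j * G l) / 2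

end RectPartition

/-- A function on `Ω` which is piecewise smooth with respect to the partition:
a global function together with, for each cell, a (smooth) extension of its
restriction to the closed cell; cellwise derivatives are derivatives of the
cell functions. -/
structure PiecewiseFun {a b c d : ℝ} (P : RectPartition a b c d) where
  toFun : ℝ × ℝ → ℝ
  cellFun : ℕ → ℕ → ℝ × ℝ → ℝ
  agree : ∀ i ∈ Finset.Icc 1 P.m, ∀ j ∈ Finset.Icc 1 P.n, ∀ z ∈ P.cell i j,
    cellFun i j z = toFun z

namespace PiecewiseFun

variable {a b c d : ℝ} {P : RectPartition a b c d}

/-- Difference of two piecewise functions. -/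
def sub (u v : PiecewiseFun P) : PiecewiseFun P where
  toFun := fun z => u.toFun z - v.toFun z
  cellFun := fun i j z => u.cellFun i j z - v.cellFun i j z
  agree := fun i hi j hj z hz => by
    simp only [u.agree i hi j hj z hz, v.agree i hi j hj z hz]

end PiecewiseFun

/-- Cellwise `∂/∂x` of a piecewise function. -/
def cellDx {a b c d : ℝ} {P : RectPartition a b c d} (v : PiecewiseFun P) :
    ℕ → ℕ → ℝ × ℝ → ℝ := fun i j => pdx (v.cellFun i j)

/-- Cellwise `∂/∂y` of a piecewise function. -/
def cellDy {a b c d : ℝ} {P : RectPartition a b c d} (v : PiecewiseFun P) :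
    ℕ → ℕ → ℝ × ℝ → ℝ := fun i j => pdy (v.cellFun i j)

/-- `v` is `C^s` on each closed cell. -/
def CellSmooth {a b c d : ℝ} (P : RectPartition a b c d) (s : ℕ)
    (u : PiecewiseFun P) : Prop :=
  ∀ i ∈ Finset.Icc 1 P.m, ∀ j ∈ Finset.Icc 1 P.n, ContDiff ℝ s (u.cellFun i j)

/-- Evaluation of a bivariate polynomial (outer variable ↦ `x`, coefficients are
polynomials in `y`). -/
def evalXY (p : Polynomial (Polynomial ℝ)) (x y : ℝ) : ℝ :=
  (p.map (Polynomial.evalRingHom y)).eval x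

/-- `f` is (globally) a polynomial of degree `≤ r` in each of the two variables. -/
def IsBiPoly (r : ℕ) (f : ℝ × ℝ → ℝ) : Prop :=
  ∃ p : Polynomial (Polynomial ℝ), p.natDegree ≤ r ∧ (∀ k, (p.coeff k).natDegree ≤ r) ∧
    ∀ x y : ℝ, f (x, y) = evalXY p x y

/-- Membership in the trial space `U_P^r`: continuous on `Ω`, vanishing on `∂Ω`,
and a bi-degree `≤ r` polynomial on each cell. -/
def IsTrialFun {a b c d : ℝ} (r : ℕ) (P : RectPartition a b c d)
    (v : PiecewiseFun P) : Prop :=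
  ContinuousOn v.toFun P.dom ∧ (∀ z ∈ P.bdry, v.toFun z = 0) ∧
  ∀ i ∈ Finset.Icc 1 P.m, ∀ j ∈ Finset.Icc 1 P.n, IsBiPoly r (v.cellFun i j)

/-- The coefficients of a test function extended by the conventions
`w_{i,0;j,l} = w_{i−1,r;j,l}` (`0` if `i = 1`) and
`w_{i,k;j,0} = w_{i,k;j−1,r}` (`0` if `j = 1`). -/
def wE (r : ℕ) (w : ℕ → ℕ → ℕ → ℕ → ℝ) (i k j l : ℕ) : ℝ :=
  if (k = 0 ∧ i = 1) ∨ (l = 0 ∧ j = 1) then 0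
  else
    w (if k = 0 then i - 1 else i) (if k = 0 then r else k)
      (if l = 0 then j - 1 else j) (if l = 0 then r else l)

/-- The jump `[w]^x_{i,k;j,l} = w_{i,k;j,l} − w_{i,k−1;j,l}`. -/
def jumpX (r : ℕ) (w : ℕ → ℕ → ℕ → ℕ → ℝ) (i k j l : ℕ) : ℝ :=
  wE r w i k j l - wE r w i (k - 1) j l

/-- The jump `[w]^y_{i,k;j,l} = w_{i,k;j,l} − w_{i,k;j,l−1}`. -/
def jumpY (r : ℕ) (w : ℕ → ℕ → ℕ → ℕ → ℝ) (i k j l : ℕ) : ℝ :=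
  wE r w i k j l - wE r w i k j (l - 1)

/-- The double jump `⌊w⌋_{i,k;j,l}`. -/
def jumpXY (r : ℕ) (w : ℕ → ℕ → ℕ → ℕ → ℝ) (i k j l : ℕ) : ℝ :=
  wE r w i k j l - wE r w i (k - 1) j l - wE r w i k j (l - 1) + wE r w i (k - 1) j (l - 1)

/-- A test function: coefficients `w_{i,k;j,l}`, `1 ≤ i ≤ m`, `1 ≤ k ≤ r`,
`1 ≤ j ≤ n`, `1 ≤ l ≤ r`, vanishing for `(i,k) = (m,r)` or `(j,l) = (n,r)`. -/
def IsTestFun {a b c d : ℝ} (r : ℕ) (P : RectPartition a b c d)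
    (w : ℕ → ℕ → ℕ → ℕ → ℝ) : Prop :=
  (∀ j ∈ Finset.Icc 1 P.n, ∀ l ∈ Finset.Icc 1 r, w P.m r j l = 0) ∧
  (∀ i ∈ Finset.Icc 1 P.m, ∀ k ∈ Finset.Icc 1 r, w i k P.n r = 0)

/-- The index set `X`: quadruples `(i,k,j,l)` with `(j,l) ≠ (n,r)`. -/
def idxX {a b c d : ℝ} (r : ℕ) (P : RectPartition a b c d) : Finset (ℕ × ℕ × ℕ × ℕ) :=
  (Finset.Icc 1 P.m ×ˢ Finset.Icc 1 r ×ˢ Finset.Icc 1 P.n ×ˢ Finset.Icc 1 r).filter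
    fun q => ¬(q.2.2.1 = P.n ∧ q.2.2.2 = r)

/-- The index set `Y`: quadruples `(i,k,j,l)` with `(i,k) ≠ (m,r)`. -/
def idxY {a b c d : ℝ} (r : ℕ) (P : RectPartition a b c d) : Finset (ℕ × ℕ × ℕ × ℕ) :=
  (Finset.Icc 1 P.m ×ˢ Finset.Icc 1 r ×ˢ Finset.Icc 1 P.n ×ˢ Finset.Icc 1 r).filter
    fun q => ¬(q.1 = P.m ∧ q.2.1 = r)

/-- The index set of interior dual volumes: `(i,k) ≠ (m,r)` and `(j,l) ≠ (n,r)`. -/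
def idxZ {a b c d : ℝ} (r : ℕ) (P : RectPartition a b c d) : Finset (ℕ × ℕ × ℕ × ℕ) :=
  (Finset.Icc 1 P.m ×ˢ Finset.Icc 1 r ×ˢ Finset.Icc 1 P.n ×ˢ Finset.Icc 1 r).filter
    fun q => ¬(q.1 = P.m ∧ q.2.1 = r) ∧ ¬(q.2.2.1 = P.n ∧ q.2.2.2 = r)

/-- The dual-mesh seminorm `|w|_{P'}`. -/
def dualSemi {a b c d : ℝ} (r : ℕ) (P : RectPartition a b c d)
    (w : ℕ → ℕ → ℕ → ℕ → ℝ) : ℝ :=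
  Real.sqrt
    ((∑ q ∈ idxX r P, (jumpX r w q.1 q.2.1 q.2.2.1 q.2.2.2) ^ 2) +
     (∑ q ∈ idxY r P, (jumpY r w q.1 q.2.1 q.2.2.1 q.2.2.2) ^ 2))

/-- The FVM bilinear form `a_P(v, w)`, with the cellwise derivatives of `v`
given by `Dxv i j` and `Dyv i j` on cell `(i,j)`.  The integrals along Gauss
lines are split at the cell interfaces `y = y_j` (resp. `x = x_i`), which only
matters for the last Gauss subinterval `l = r` (resp. `k = r`). -/
def aP {a b c d : ℝ} (r : ℕ) (G : ℕ → ℝ) (P : RectPartition a b c d)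
    (α : ℝ × ℝ → ℝ) (Dxv Dyv : ℕ → ℕ → ℝ × ℝ → ℝ) (w : ℕ → ℕ → ℕ → ℕ → ℝ) : ℝ :=
  (∑ q ∈ idxX r P,
    jumpX r w q.1 q.2.1 q.2.2.1 q.2.2.2 *
      ((∫ t in (P.gy r G q.2.2.1 q.2.2.2)..(min (P.gy r G q.2.2.1 (q.2.2.2 + 1)) (P.y q.2.2.1)),
          α (P.gx r G q.1 q.2.1, t) * Dxv q.1 q.2.2.1 (P.gx r G q.1 q.2.1, t)) +
       (∫ t in (P.y q.2.2.1)..(max (P.gy r G q.2.2.1 (q.2.2.2 + 1)) (P.y q.2.2.1)),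
          α (P.gx r G q.1 q.2.1, t) * Dxv q.1 (q.2.2.1 + 1) (P.gx r G q.1 q.2.1, t)))) +
  (∑ q ∈ idxY r P,
    jumpY r w q.1 q.2.1 q.2.2.1 q.2.2.2 *
      ((∫ t in (P.gx r G q.1 q.2.1)..(min (P.gx r G q.1 (q.2.1 + 1)) (P.x q.1)),
          α (t, P.gy r G q.2.2.1 q.2.2.2) * Dyv q.1 q.2.2.1 (t, P.gy r G q.2.2.1 q.2.2.2)) +
       (∫ t in (P.x q.1)..(max (P.gx r G q.1 (q.2.1 + 1)) (P.x q.1)),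
          α (t, P.gy r G q.2.2.1 q.2.2.2) * Dyv (q.1 + 1) q.2.2.1 (t, P.gy r G q.2.2.1 q.2.2.2))))

/-- The broken `H¹` seminorm `|v|₁` computed cellwise. -/
def semiH1 {a b c d : ℝ} (P : RectPartition a b c d) (v : PiecewiseFun P) : ℝ :=
  Real.sqrt (∑ i ∈ Finset.Icc 1 P.m, ∑ j ∈ Finset.Icc 1 P.n,
    ∫ z in P.cell i j, ((cellDx v i j z) ^ 2 + (cellDy v i j z) ^ 2))

/-- The mesh-dependent seminorm `|v|_P` (broken `H²`-type seminorm). -/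
def semiP {a b c d : ℝ} (P : RectPartition a b c d) (v : PiecewiseFun P) : ℝ :=
  Real.sqrt (∑ i ∈ Finset.Icc 1 P.m, ∑ j ∈ Finset.Icc 1 P.n,
    ((∫ z in P.cell i j, ((cellDx v i j z) ^ 2 + (cellDy v i j z) ^ 2)) +
      (P.hx i ^ 2 + P.hy j ^ 2) *
        ∫ z in P.cell i j,
          ((pdx (pdx (v.cellFun i j)) z) ^ 2 + 2 * (pdy (pdx (v.cellFun i j)) z) ^ 2 +
            (pdy (pdy (v.cellFun i j)) z) ^ 2)))

/-- The broken seminorm `|u|_{s,P}`. -/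
def brokenSemi {a b c d : ℝ} (P : RectPartition a b c d) (u : PiecewiseFun P) (s : ℕ) : ℝ :=
  Real.sqrt (∑ i ∈ Finset.Icc 1 P.m, ∑ j ∈ Finset.Icc 1 P.n, ∑ t ∈ Finset.range (s + 1),
    ∫ z in P.cell i j, (pdx^[t] (pdy^[s - t] (u.cellFun i j)) z) ^ 2)

/-- The broken norm `‖u‖_{s,P} = (Σ_{t=0}^{s} |u|_{t,P}²)^{1/2}`. -/
def brokenNorm {a b c d : ℝ} (P : RectPartition a b c d) (u : PiecewiseFun P) (s : ℕ) : ℝ :=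
  Real.sqrt (∑ t ∈ Finset.range (s + 1), (brokenSemi P u t) ^ 2)

/-- `w = Πv`: the test function determined by the double-jump constraints
`⌊Πv⌋_{i,k;j,l} = A^x_{i,k} A^y_{j,l} ∂²v/∂x∂y(g^x_{i,k}, g^y_{j,l})`. -/
def IsPiOf {a b c d : ℝ} (r : ℕ) (G A : ℕ → ℝ) (P : RectPartition a b c d)
    (v : PiecewiseFun P) (w : ℕ → ℕ → ℕ → ℕ → ℝ) : Prop :=
  IsTestFun r P w ∧
  ∀ i ∈ Finset.Icc 1 P.m, ∀ k ∈ Finset.Icc 1 r, ∀ j ∈ Finset.Icc 1 P.n, ∀ l ∈ Finset.Icc 1 r,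
    ¬(i = P.m ∧ k = r) → ¬(j = P.n ∧ l = r) →
    jumpXY r w i k j l =
      (P.hx i * A k / 2) * (P.hy j * A l / 2) *
        pdy (pdx (v.cellFun i j)) (P.gx r G i k, P.gy r G j l)

/-- `α` is piecewise constant with respect to `P`. -/
def PiecewiseConstant {a b c d : ℝ} (P : RectPartition a b c d) (α : ℝ × ℝ → ℝ) : Prop :=
  ∀ i ∈ Finset.Icc 1 P.m, ∀ j ∈ Finset.Icc 1 P.n, ∃ cst : ℝ, ∀ z ∈ P.openCell i j, α z = cst

/-- The cellwise fluxes `α ∂u/∂x`, `α ∂u/∂y` extend continuously to `Ω`. -/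
def FluxContinuous {a b c d : ℝ} (P : RectPartition a b c d) (α : ℝ × ℝ → ℝ)
    (u : PiecewiseFun P) : Prop :=
  ∃ Fx Fy : ℝ × ℝ → ℝ, ContinuousOn Fx P.dom ∧ ContinuousOn Fy P.dom ∧
    ∀ i ∈ Finset.Icc 1 P.m, ∀ j ∈ Finset.Icc 1 P.n, ∀ z ∈ P.openCell i j,
      Fx z = α z * cellDx u i j z ∧ Fy z = α z * cellDy u i j z

/-- The iterated integral of `f` over the rectangle `[x₁,x₂] × [y₁,y₂]`. -/
def rectInt (f : ℝ × ℝ → ℝ) (x₁ x₂ y₁ y₂ : ℝ) : ℝ :=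
  ∫ s in x₁..x₂, ∫ t in y₁..y₂, f (s, t)

/-- The integral over the dual volume `τ'_{i,k;j,l} = [g^x_{i,k}, g^x_{i,k+1}] ×
[g^y_{j,l}, g^y_{j,l+1}]` of a cellwise-defined integrand `F i j`, split along
the cell interfaces `x = x_i` and `y = y_j`. -/
def dualCellInt {a b c d : ℝ} (r : ℕ) (G : ℕ → ℝ) (P : RectPartition a b c d)
    (F : ℕ → ℕ → ℝ × ℝ → ℝ) (i k j l : ℕ) : ℝ :=
  rectInt (F i j) (P.gx r G i k) (min (P.gx r G i (k + 1)) (P.x i))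
    (P.gy r G j l) (min (P.gy r G j (l + 1)) (P.y j)) +
  rectInt (F (i + 1) j) (P.x i) (max (P.gx r G i (k + 1)) (P.x i))
    (P.gy r G j l) (min (P.gy r G j (l + 1)) (P.y j)) +
  rectInt (F i (j + 1)) (P.gx r G i k) (min (P.gx r G i (k + 1)) (P.x i))
    (P.y j) (max (P.gy r G j (l + 1)) (P.y j)) +
  rectInt (F (i + 1) (j + 1)) (P.x i) (max (P.gx r G i (k + 1)) (P.x i))
    (P.y j) (max (P.gy r G j (l + 1)) (P.y j))

/-- The cellwise source term `f = −α (∂²u/∂x² + ∂²u/∂y²)` (for piecewise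
constant `α`). -/
def cellSource {a b c d : ℝ} {P : RectPartition a b c d} (α : ℝ × ℝ → ℝ)
    (u : PiecewiseFun P) (i j : ℕ) (z : ℝ × ℝ) : ℝ :=
  -(α z * (pdx (pdx (u.cellFun i j)) z + pdy (pdy (u.cellFun i j)) z))

/-- The right-hand side `Σ w_{i,k;j,l} ∫_{τ'_{i,k;j,l}} f` of the FV scheme. -/
def fvRHS {a b c d : ℝ} (r : ℕ) (G : ℕ → ℝ) (P : RectPartition a b c d)
    (α : ℝ × ℝ → ℝ) (u : PiecewiseFun P) (w : ℕ → ℕ → ℕ → ℕ → ℝ) : ℝ :=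
  ∑ q ∈ idxZ r P, w q.1 q.2.1 q.2.2.1 q.2.2.2 *
    dualCellInt r G P (cellSource α u) q.1 q.2.1 q.2.2.1 q.2.2.2

/-- `uP` is a finite volume solution for the exact solution `u`. -/
def IsFVSolution {a b c d : ℝ} (r : ℕ) (G : ℕ → ℝ) (P : RectPartition a b c d)
    (α : ℝ × ℝ → ℝ) (u uP : PiecewiseFun P) : Prop :=
  IsTrialFun r P uP ∧
  ∀ w, IsTestFun r P w → aP r G P α (cellDx uP) (cellDy uP) w = fvRHS r G P α u w

/-- The Lobatto node in cell `(i,j)` with 0-based indices `0 ≤ k, l ≤ r`. -/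
def lobattoNode {a b c d : ℝ} (P : RectPartition a b c d) (L : ℕ → ℝ)
    (i j k l : ℕ) : ℝ × ℝ :=
  ((P.x (i - 1) + P.x i + P.hx i * L k) / 2, (P.y (j - 1) + P.y j + P.hy j * L l) / 2)

/-- `uI` is the Lobatto interpolant of `u` in the trial space `U_P^r`. -/
def IsLobattoInterp {a b c d : ℝ} (r : ℕ) (L : ℕ → ℝ) (P : RectPartition a b c d)
    (u : ℝ × ℝ → ℝ) (uI : PiecewiseFun P) : Prop :=
  IsTrialFun r P uI ∧
  ∀ i ∈ Finset.Icc 1 P.m, ∀ j ∈ Finset.Icc 1 P.n,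
    ∀ k ∈ Finset.Icc 0 r, ∀ l ∈ Finset.Icc 0 r,
      uI.toFun (lobattoNode P L i j k l) = u (lobattoNode P L i j k l)

/-- The piecewise oscillation `osc_P(α)`: the maximum over all cells of
`ess sup α − ess inf α`. -/
def oscP {a b c d : ℝ} (P : RectPartition a b c d) (α : ℝ × ℝ → ℝ) : ℝ :=
  (Finset.Icc 1 P.m ×ˢ Finset.Icc 1 P.n).sup'
    (Finset.Nonempty.product (Finset.nonempty_Icc.mpr P.hm) (Finset.nonempty_Icc.mpr P.hn))
    fun p => essSup α (volume.restrict (P.cell p.1 p.2)) -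
      essInf α (volume.restrict (P.cell p.1 p.2))

end

theorem iterate_derivative_X_sq_sub_one_pow (r n : ℕ) :
    (X ^ 2 - 1 : ℝ[X]) * derivative^[n + 2] ((X ^ 2 - 1) ^ r) +
        C (2 * (n + 1) : ℝ) * X * derivative^[n + 1] ((X ^ 2 - 1) ^ r) +
        C (n * (n + 1) : ℝ) * derivative^[n] ((X ^ 2 - 1) ^ r) =
      C (2 * r : ℝ) * X * derivative^[n + 1] ((X ^ 2 - 1) ^ r) +
        C (2 * r * (n + 1) : ℝ) * derivative^[n] ((X ^ 2 - 1) ^ r) := by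
  have h2 : (C (2 : ℝ) : ℝ[X]) = 2 := map_ofNat C 2
  induction n with
  | zero =>
    have h : (X ^ 2 - 1 : ℝ[X]) * derivative ((X ^ 2 - 1 : ℝ[X]) ^ r) =
        C (2 * r : ℝ) * X * (X ^ 2 - 1) ^ r := by
      cases r with
      | zero => simp
      | succ s =>
        rw [derivative_pow]
        simp only [derivative_sub, derivative_X_pow, derivative_one, map_mul, map_natCast,
          map_ofNat, Nat.add_sub_cancel]
        push_cast
        ring
    have h' := congrArg derivative h
    simp only [derivative_mul, derivative_sub, derivative_X_pow, derivative_one, derivative_C,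
      derivative_X] at h'
    simp only [Function.iterate_succ_apply', Function.iterate_zero, id]
    simp [h2] at h' ⊢
    linear_combination h'
  | succ n ih =>
    have h' := congrArg derivative ih
    simp only [Function.iterate_succ_apply', derivative_mul, derivative_add, derivative_sub,
      derivative_X_pow, derivative_one, derivative_C, derivative_X] at h' ⊢
    simp [h2] at h' ⊢
    linear_combination h'

/-- The Legendre differential equation in divergence form. -/
theorem derivative_lobatto_nodal (r : ℕ) :
    derivative ((X ^ 2 - 1) * derivative (Leg r)) = C (r * (r + 1) : ℝ) * Leg r := by
  have h2 : (C (2 : ℝ) : ℝ[X]) = 2 := map_ofNat C 2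
  have h := iterate_derivative_X_sq_sub_one_pow r r
  have hL : Leg r = derivative^[r] ((X ^ 2 - 1) ^ r) := rfl
  simp only [Function.iterate_succ_apply', ← hL] at h
  simp only [derivative_mul, derivative_sub, derivative_X_pow, derivative_one]
  simp [h2] at h ⊢
  linear_combination h

theorem iterate_derivative_lobatto_nodal (r : ℕ) (hr : 1 ≤ r) :
    ∃ κ : ℝ, κ ≠ 0 ∧ derivative^[r + 1] ((X ^ 2 - 1) * derivative (Leg r)) = C κ := by
  have hL : Leg r = derivative^[r] ((X ^ 2 - 1) ^ r) := rfl
  have hmonic : ((X ^ 2 - 1 : ℝ[X]) ^ r).Monic :=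
    (monic_X_pow_sub_C (1 : ℝ) (by norm_num : (2 : ℕ) ≠ 0)).pow r
  have hdeg : ((X ^ 2 - 1 : ℝ[X]) ^ r).natDegree = r + r := by
    have h2 : (X ^ 2 - 1 : ℝ[X]).natDegree = 2 := natDegree_X_pow_sub_C (n := 2) (r := (1 : ℝ))
    rw [natDegree_pow, h2]; ring
  have htop : derivative^[r + r] ((X ^ 2 - 1 : ℝ[X]) ^ r) = C (((r + r).factorial : ℕ) : ℝ) := by
    have h0 : (derivative^[r + r] ((X ^ 2 - 1 : ℝ[X]) ^ r)).natDegree = 0 := by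
      have := natDegree_iterate_derivative ((X ^ 2 - 1 : ℝ[X]) ^ r) (r + r)
      omega
    rw [eq_C_of_natDegree_eq_zero h0, coeff_iterate_derivative]
    have hc : ((X ^ 2 - 1 : ℝ[X]) ^ r).coeff (0 + (r + r)) = 1 := by
      rw [zero_add, ← hdeg]; exact hmonic
    rw [hc, zero_add, Nat.descFactorial_self]
    simp
  refine ⟨(r * (r + 1) : ℝ) * ((r + r).factorial : ℕ), ?_, ?_⟩
  · have : (0 : ℝ) < r := by exact_mod_cast hr
    positivity
  · rw [Function.iterate_succ_apply, derivative_lobatto_nodal, iterate_derivative_C_mul, hL,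
      ← Function.iterate_add_apply, htop, ← C_mul]

theorem iterate_derivative_comp_affine (p : ℝ[X]) (α β : ℝ) (j : ℕ) :
    derivative^[j] (p.comp (C α * X + C β)) =
      C (α ^ j) * (derivative^[j] p).comp (C α * X + C β) := by
  induction j with
  | zero => simp
  | succ j ih =>
    rw [Function.iterate_succ_apply', Function.iterate_succ_apply', ih, derivative_mul,
      derivative_comp, derivative_C]
    simp
    ring

theorem iteratedDeriv_polynomial (p : ℝ[X]) (j : ℕ) :
    iteratedDeriv j (fun x => p.eval x) = fun x => (derivative^[j] p).eval x := by
  induction j with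
  | zero => simp
  | succ j ih =>
    rw [iteratedDeriv_succ, ih, Function.iterate_succ_apply']
    ext x
    exact Polynomial.deriv _

/-- Iterated Rolle theorem: a function with `n + 1` zeros in `[A, B]` has, for every `j ≤ n`,
a zero of its `j`-th derivative there. -/
theorem exists_iteratedDeriv_eq_zero {A B : ℝ} (n : ℕ) :
    ∀ (E : ℝ → ℝ) (z : ℕ → ℝ), ContDiff ℝ n E → (∀ k < n, z k < z (k + 1)) →
      (∀ k ≤ n, z k ∈ Set.Icc A B) → (∀ k ≤ n, E (z k) = 0) →
      ∀ j ≤ n, ∃ x ∈ Set.Icc A B, iteratedDeriv j E x = 0 := by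
  induction n with
  | zero =>
    intro E z _ _ hz h0 j hj
    obtain rfl : j = 0 := by omega
    exact ⟨z 0, hz 0 le_rfl, by simpa using h0 0 le_rfl⟩
  | succ n ih =>
    intro E z hE hlt hz h0 j hj
    cases j with
    | zero => exact ⟨z 0, hz 0 (by omega), by simpa using h0 0 (by omega)⟩
    | succ j =>
      have hrolle : ∀ k, ∃ x, k < n + 1 → (z k < x ∧ x < z (k + 1)) ∧ deriv E x = 0 := by
        intro k
        by_cases hk : k < n + 1
        · obtain ⟨x, hx, hx0⟩ := exists_deriv_eq_zero (f := E) (hlt k hk) hE.continuous.continuousOn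
            ((h0 k hk.le).trans (h0 (k + 1) hk).symm)
          exact ⟨x, fun _ => ⟨hx, hx0⟩⟩
        · exact ⟨0, fun h => absurd h hk⟩
      choose z' hz' using hrolle
      have hE' : ContDiff ℝ n (deriv E) := by
        have : ContDiff ℝ ((n : WithTop ℕ∞) + 1) E := by exact_mod_cast hE
        exact (contDiff_succ_iff_deriv.1 this).2.2
      obtain ⟨x, hx, hx0⟩ := ih (deriv E) z' hE'
        (fun k hk => (hz' k (by omega)).1.2.trans (hz' (k + 1) (by omega)).1.1)
        (fun k hk => ⟨(hz k (by omega)).1.trans (hz' k (by omega)).1.1.le,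
          (hz' k (by omega)).1.2.le.trans (hz (k + 1) (by omega)).2⟩)
        (fun k hk => (hz' k (by omega)).2) j (by omega)
      exact ⟨x, hx, by rw [iteratedDeriv_succ']; exact hx0⟩

theorem continuous_iteratedDeriv_of_contDiff {E : ℝ → ℝ} {N j : ℕ} (hE : ContDiff ℝ N E)
    (hj : j ≤ N) : Continuous (iteratedDeriv j E) :=
  hE.continuous_iteratedDeriv j (by exact_mod_cast hj)

/-- A `C^{N+1}` function all of whose derivatives of order `≤ N` have a zero in `[A, B]` is
controlled, with its derivatives, by the `L¹` norm of its derivative of order `N + 1`. -/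
theorem abs_iteratedDeriv_le_of_zeros {A B : ℝ} (N : ℕ) {E : ℝ → ℝ}
    (hE : ContDiff ℝ (N + 1 : ℕ) E)
    (h0 : ∀ j ≤ N, ∃ x ∈ Set.Icc A B, iteratedDeriv j E x = 0) (n : ℕ) :
    ∀ j, j + n = N → ∀ x ∈ Set.Icc A B,
      |iteratedDeriv j E x| ≤ (B - A) ^ n * ∫ t in A..B, |iteratedDeriv (N + 1) E t| := by
  have hftc : ∀ j ≤ N, ∀ z x, ∫ t in z..x, iteratedDeriv (j + 1) E t =
      iteratedDeriv j E x - iteratedDeriv j E z := by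
    intro j hj z x
    apply intervalIntegral.integral_eq_sub_of_hasDerivAt
    · intro t _
      rw [iteratedDeriv_succ]
      exact ((hE.differentiable_iteratedDeriv j (by exact_mod_cast Nat.lt_succ_of_le hj)) t).hasDerivAt
    · exact (continuous_iteratedDeriv_of_contDiff hE (by omega)).intervalIntegrable _ _
  induction n with
  | zero =>
    intro j hj x hx
    obtain rfl : j = N := by omega
    obtain ⟨z, hz, hz0⟩ := h0 j le_rfl
    have h1 := hftc j le_rfl z x
    rw [hz0, sub_zero] at h1
    have hAB : A ≤ B := hx.1.trans hx.2
    have hc := (continuous_iteratedDeriv_of_contDiff hE (le_refl (j + 1))).abs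
    rw [← h1, pow_zero, one_mul, intervalIntegral.integral_of_le hAB]
    refine (intervalIntegral.norm_integral_le_integral_norm_uIoc
      (f := iteratedDeriv (j + 1) E)).trans ?_
    refine setIntegral_mono_set hc.integrableOn_Ioc
      (Filter.Eventually.of_forall fun t => abs_nonneg _) ?_
    refine LE.le.eventuallyLE ?_
    rintro t ⟨h2, h3⟩
    exact ⟨(le_min hz.1 hx.1).trans_lt h2, h3.trans (max_le hz.2 hx.2)⟩
  | succ n ih =>
    intro j hj x hx
    obtain ⟨z, hz, hz0⟩ := h0 j (by omega)
    have h1 := hftc j (by omega) z x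
    rw [hz0, sub_zero] at h1
    have hAB : A ≤ B := hx.1.trans hx.2
    set J := ∫ t in A..B, |iteratedDeriv (N + 1) E t| with hJ
    have hJ0 : 0 ≤ J := intervalIntegral.integral_nonneg hAB fun t _ => abs_nonneg _
    rw [← h1]
    have hb := intervalIntegral.norm_integral_le_of_norm_le_const (a := z) (b := x)
      (C := (B - A) ^ n * J) (f := iteratedDeriv (j + 1) E) (by
        rintro t ⟨h2, h3⟩
        exact ih (j + 1) (by omega) t ⟨(le_min hz.1 hx.1).trans h2.le, h3.trans (max_le hz.2 hx.2)⟩)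
    refine hb.trans ?_
    have habs : |x - z| ≤ B - A := by
      rw [abs_le]; constructor <;> linarith [hx.1, hx.2, hz.1, hz.2]
    have hBA : 0 ≤ B - A := by linarith
    calc (B - A) ^ n * J * |x - z| ≤ (B - A) ^ n * J * (B - A) := by gcongr
      _ = (B - A) ^ (n + 1) * J := by ring

/-- Interpolation error at `r + 1` nodes. -/
theorem abs_sub_eval_le_of_interp {A B : ℝ} {r : ℕ} {z : ℕ → ℝ} (hlt : ∀ k < r, z k < z (k + 1))
    (hz : ∀ k ≤ r, z k ∈ Set.Icc A B) {φ : ℝ → ℝ} (hφ : ContDiff ℝ (r + 1 : ℕ) φ)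
    {p : ℝ[X]} (hp : p.natDegree ≤ r) (hint : ∀ k ≤ r, φ (z k) = p.eval (z k))
    {x : ℝ} (hx : x ∈ Set.Icc A B) :
    |φ x - p.eval x| ≤ (B - A) ^ r * ∫ t in A..B, |iteratedDeriv (r + 1) φ t| := by
  have hpc : ContDiff ℝ (r + 1 : ℕ) fun x => p.eval x := by simpa using p.contDiff_aeval (𝕜 := ℝ) _
  have hE : ContDiff ℝ (r + 1 : ℕ) fun x => φ x - p.eval x := hφ.sub hpc
  have h := abs_iteratedDeriv_le_of_zeros r hE
    (exists_iteratedDeriv_eq_zero r _ z (hE.of_le (by exact_mod_cast Nat.le_succ r)) hlt hz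
      fun k hk => sub_eq_zero.2 (hint k hk)) r 0 (by omega) x hx
  have hd : ∀ t, iteratedDeriv (r + 1) (fun x => φ x - p.eval x) t = iteratedDeriv (r + 1) φ t := by
    intro t
    rw [iteratedDeriv_fun_sub hφ.contDiffAt hpc.contDiffAt, iteratedDeriv_polynomial,
      iterate_derivative_eq_zero (by omega)]
    simp
  simpa only [iteratedDeriv_zero, hd] using h

/-- Superconvergence of the derivative of the interpolant at critical points of a nodal
polynomial of degree `r + 1`. -/
theorem abs_deriv_sub_eval_le_of_interp {A B : ℝ} {r : ℕ} {z : ℕ → ℝ}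
    (hlt : ∀ k < r, z k < z (k + 1)) (hz : ∀ k ≤ r, z k ∈ Set.Icc A B)
    {φ : ℝ → ℝ} (hφ : ContDiff ℝ (r + 2 : ℕ) φ)
    {p : ℝ[X]} (hp : p.natDegree ≤ r) (hint : ∀ k ≤ r, φ (z k) = p.eval (z k))
    {ω : ℝ[X]} {κ : ℝ} (hκ : κ ≠ 0) (hω : derivative^[r + 1] ω = C κ)
    (hω0 : ∀ k ≤ r, ω.eval (z k) = 0) {g : ℝ} (hg : g ∈ Set.Icc A B)
    (hωg : (derivative ω).eval g = 0) :
    |deriv φ g - (derivative p).eval g| ≤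
      (B - A) ^ r * ∫ t in A..B, |iteratedDeriv (r + 2) φ t| := by
  set c : ℝ := iteratedDeriv (r + 1) φ g / κ with hc
  set q : ℝ[X] := p + C c * ω with hq
  have hqc : ∀ n : ℕ, ContDiff ℝ n fun x => q.eval x := fun n => by
    simpa using q.contDiff_aeval (𝕜 := ℝ) _
  have hE : ContDiff ℝ (r + 2 : ℕ) fun x => φ x - q.eval x := hφ.sub (hqc _)
  have hdE : ∀ j ≤ r + 2, ∀ t, iteratedDeriv j (fun x => φ x - q.eval x) t =
      iteratedDeriv j φ t - (derivative^[j] q).eval t := by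
    intro j hj t
    rw [iteratedDeriv_fun_sub (hφ.contDiffAt.of_le (by exact_mod_cast hj)) (hqc _).contDiffAt,
      iteratedDeriv_polynomial]
  have hq1 : derivative^[r + 1] q = C (c * κ) := by
    rw [hq, iterate_map_add, iterate_derivative_C_mul, hω,
      iterate_derivative_eq_zero (by omega), zero_add, ← C_mul]
  have hq2 : derivative^[r + 2] q = 0 := by
    rw [Function.iterate_succ_apply', hq1, derivative_C]
  have hzeros : ∀ j ≤ r + 1, ∃ x ∈ Set.Icc A B, iteratedDeriv j (fun x => φ x - q.eval x) x = 0 := by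
    intro j hj
    rcases Nat.lt_or_ge r j with h | h
    · obtain rfl : j = r + 1 := by omega
      refine ⟨g, hg, ?_⟩
      rw [hdE _ (by omega), hq1, eval_C, hc, div_mul_cancel₀ _ hκ, sub_self]
    · refine exists_iteratedDeriv_eq_zero r _ z (hE.of_le (by exact_mod_cast (by omega : r ≤ r + 2)))
        hlt hz (fun k hk => ?_) j h
      simp [hq, hω0 k hk, hint k hk]
  have h := abs_iteratedDeriv_le_of_zeros (r + 1) hE hzeros r 1 (by omega) g hg
  rw [hdE 1 (by omega)] at h
  simp only [hdE _ le_rfl, hq2, eval_zero, sub_zero] at h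
  simpa [hq, hωg] using h

theorem injOn_range_of_lt_succ {r : ℕ} {z : ℕ → ℝ} (hz : ∀ k < r, z k < z (k + 1)) :
    Set.InjOn z (Finset.range (r + 1) : Set ℕ) := by
  have hmono : ∀ i j, i < j → j ≤ r → z i < z j := by
    intro i j hij
    induction j, hij using Nat.le_induction with
    | base => intro h; exact hz i (by omega)
    | succ j hj ih => intro h; exact (ih (by omega)).trans (hz j (by omega))
  intro i hi j hj hij
  simp only [Finset.coe_range, Set.mem_Iio] at hi hj
  rcases lt_trichotomy i j with h | h | h
  · exact absurd hij (hmono i j h (by omega)).ne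
  · exact h
  · exact absurd hij (hmono j i h (by omega)).ne'

/-- Inverse-type estimate: the derivative of a polynomial of degree `≤ r` at given points is
controlled by its oscillation over `r + 1` nodes. -/
theorem exists_derivative_eval_bound {r : ℕ} {z : ℕ → ℝ} (hz : ∀ k < r, z k < z (k + 1))
    (G : ℕ → ℝ) :
    ∃ K : ℝ, 0 ≤ K ∧ ∀ (D : ℝ[X]) (M : ℝ), D.natDegree ≤ r →
      (∀ k ≤ r, |D.eval (z k) - D.eval (z 0)| ≤ M) →
      ∀ k ∈ Finset.Icc 1 r, |(derivative D).eval (G k)| ≤ K * M := by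
  classical
  have hinj := injOn_range_of_lt_succ hz
  set b : ℕ → ℝ[X] := fun i => Lagrange.basis (Finset.range (r + 1)) z i with hb
  refine ⟨∑ k ∈ Finset.Icc 1 r, ∑ i ∈ Finset.range (r + 1), |(derivative (b i)).eval (G k)|,
    by positivity, ?_⟩
  intro D M hD hM k hk
  have hM0 : 0 ≤ M := (abs_nonneg _).trans (hM 0 (by omega))
  have hdeg : (D - C (D.eval (z 0))).degree < (Finset.range (r + 1)).card := by
    rw [Finset.card_range]
    refine lt_of_le_of_lt degree_le_natDegree ?_
    rw [natDegree_sub_C]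
    exact_mod_cast Nat.lt_succ_of_le hD
  have hrep := Lagrange.eq_interpolate hinj hdeg
  have hder : (derivative D).eval (G k) = ∑ i ∈ Finset.range (r + 1),
      (D.eval (z i) - D.eval (z 0)) * (derivative (b i)).eval (G k) := by
    have h1 : derivative D = derivative (D - C (D.eval (z 0))) := by simp
    rw [h1, hrep, Lagrange.interpolate_apply, derivative_sum, eval_finsetSum]
    refine Finset.sum_congr rfl fun i _ => ?_
    simp [hb]
  rw [hder, Finset.sum_mul]
  calc |∑ i ∈ Finset.range (r + 1), (D.eval (z i) - D.eval (z 0)) * (derivative (b i)).eval (G k)|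
      ≤ ∑ i ∈ Finset.range (r + 1),
          |(D.eval (z i) - D.eval (z 0)) * (derivative (b i)).eval (G k)| :=
        Finset.abs_sum_le_sum_abs _ _
    _ ≤ ∑ i ∈ Finset.range (r + 1), |(derivative (b i)).eval (G k)| * M := by
        refine Finset.sum_le_sum fun i hi => ?_
        rw [abs_mul, mul_comm]
        have := hM i (by simpa [Nat.lt_succ_iff] using hi)
        gcongr
    _ ≤ _ := by
        rw [← Finset.sum_mul]
        exact Finset.single_le_sum
          (f := fun k => (∑ i ∈ Finset.range (r + 1), |(derivative (b i)).eval (G k)|) * M)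
          (fun _ _ => by positivity) hk

theorem contDiff_pdx {f : ℝ × ℝ → ℝ} {n : ℕ} (hf : ContDiff ℝ (n + 1 : ℕ) f) :
    ContDiff ℝ n (pdx f) :=
  (hf.fderiv_right (m := n) (by exact_mod_cast le_rfl)).clm_apply contDiff_const

theorem contDiff_pdy {f : ℝ × ℝ → ℝ} {n : ℕ} (hf : ContDiff ℝ (n + 1 : ℕ) f) :
    ContDiff ℝ n (pdy f) :=
  (hf.fderiv_right (m := n) (by exact_mod_cast le_rfl)).clm_apply contDiff_const

theorem contDiff_iterate_pdx (j : ℕ) : ∀ {f : ℝ × ℝ → ℝ} {n : ℕ}, ContDiff ℝ (n + j : ℕ) f →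
    ContDiff ℝ n (pdx^[j] f) := by
  induction j with
  | zero => intro f n hf; exact hf
  | succ j ih =>
    intro f n hf
    exact ih (contDiff_pdx (n := n + j) hf)

theorem contDiff_iterate_pdy (j : ℕ) : ∀ {f : ℝ × ℝ → ℝ} {n : ℕ}, ContDiff ℝ (n + j : ℕ) f →
    ContDiff ℝ n (pdy^[j] f) := by
  induction j with
  | zero => intro f n hf; exact hf
  | succ j ih =>
    intro f n hf
    exact ih (contDiff_pdy (n := n + j) hf)

theorem hasDerivAt_section_fst {f : ℝ × ℝ → ℝ} (hf : Differentiable ℝ f) (x y : ℝ) :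
    HasDerivAt (fun s => f (s, y)) (pdx f (x, y)) x := by
  have h : HasDerivAt (fun s : ℝ => (s, y)) ((1 : ℝ), (0 : ℝ)) x :=
    (hasDerivAt_id x).prodMk (hasDerivAt_const x y)
  exact (hf (x, y)).hasFDerivAt.comp_hasDerivAt x h

theorem hasDerivAt_section_snd {f : ℝ × ℝ → ℝ} (hf : Differentiable ℝ f) (x y : ℝ) :
    HasDerivAt (fun s => f (x, s)) (pdy f (x, y)) y := by
  have h : HasDerivAt (fun s : ℝ => (x, s)) ((0 : ℝ), (1 : ℝ)) y :=
    (hasDerivAt_const y x).prodMk (hasDerivAt_id y)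
  exact (hf (x, y)).hasFDerivAt.comp_hasDerivAt y h

theorem iteratedDeriv_section_fst (j : ℕ) {f : ℝ × ℝ → ℝ} (hf : ContDiff ℝ j f) (y : ℝ) :
    iteratedDeriv j (fun s => f (s, y)) = fun x => pdx^[j] f (x, y) := by
  induction j generalizing f with
  | zero => simp
  | succ j ih =>
    have hd : deriv (fun s => f (s, y)) = fun x => pdx f (x, y) := by
      ext x
      exact (hasDerivAt_section_fst (hf.differentiable (by simp)) x y).deriv
    rw [iteratedDeriv_succ', hd, ih (contDiff_pdx hf), Function.iterate_succ_apply]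

theorem iteratedDeriv_section_snd (j : ℕ) {f : ℝ × ℝ → ℝ} (hf : ContDiff ℝ j f) (x : ℝ) :
    iteratedDeriv j (fun s => f (x, s)) = fun y => pdy^[j] f (x, y) := by
  induction j generalizing f with
  | zero => simp
  | succ j ih =>
    have hd : deriv (fun s => f (x, s)) = fun y => pdy f (x, y) := by
      ext y
      exact (hasDerivAt_section_snd (hf.differentiable (by simp)) x y).deriv
    rw [iteratedDeriv_succ', hd, ih (contDiff_pdy hf), Function.iterate_succ_apply]

theorem pdy_pdx_comm {f : ℝ × ℝ → ℝ} (hf : ContDiff ℝ 2 f) : pdy (pdx f) = pdx (pdy f) := by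
  ext z
  have hd : DifferentiableAt ℝ (fderiv ℝ f) z :=
    ((hf.fderiv_right (m := 1) (by norm_num)).differentiable (by simp)) z
  have h1 : ∀ v w : ℝ × ℝ, fderiv ℝ (fun z => fderiv ℝ f z v) z w =
      fderiv ℝ (fderiv ℝ f) z w v := by
    intro v w
    rw [fderiv_clm_apply hd (differentiableAt_const v)]
    simp
  have hsymm : IsSymmSndFDerivAt ℝ f z :=
    hf.contDiffAt.isSymmSndFDerivAt (by simp)
  exact (h1 (1, 0) (0, 1)).trans ((hsymm.eq _ _).trans (h1 (0, 1) (1, 0)).symm)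

theorem pdy_iterate_pdx_comm (k : ℕ) {f : ℝ × ℝ → ℝ} (hf : ContDiff ℝ (k + 1 : ℕ) f) :
    pdy (pdx^[k] f) = pdx^[k] (pdy f) := by
  induction k generalizing f with
  | zero => rfl
  | succ k ih =>
    rw [Function.iterate_succ_apply, Function.iterate_succ_apply, ih (contDiff_pdx hf),
      pdy_pdx_comm (hf.of_le (by exact_mod_cast (by omega : 2 ≤ k + 1 + 1)))]

theorem pdx_comp_swap (f : ℝ × ℝ → ℝ) : pdx (f ∘ Prod.swap) = pdy f ∘ Prod.swap := by
  ext z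
  have h := (ContinuousLinearEquiv.prodComm ℝ ℝ ℝ).comp_right_fderiv (f := f) (x := z)
  have h' := congrArg (fun T : ℝ × ℝ →L[ℝ] ℝ => T (1, 0)) h
  have hc : ⇑(ContinuousLinearEquiv.prodComm ℝ ℝ ℝ) = Prod.swap := rfl
  simpa [pdx, pdy, hc] using h'

theorem pdy_comp_swap (f : ℝ × ℝ → ℝ) : pdy (f ∘ Prod.swap) = pdx f ∘ Prod.swap := by
  have h := congrArg (fun F => F ∘ Prod.swap) (pdx_comp_swap (f ∘ Prod.swap))
  simp only [Function.comp_assoc, Prod.swap_swap_eq, Function.comp_id] at h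
  exact h.symm

theorem iterate_pdx_comp_swap (j : ℕ) (f : ℝ × ℝ → ℝ) :
    pdx^[j] (f ∘ Prod.swap) = pdy^[j] f ∘ Prod.swap := by
  induction j generalizing f with
  | zero => rfl
  | succ j ih => rw [Function.iterate_succ_apply, pdx_comp_swap, ih, Function.iterate_succ_apply]

theorem iterate_pdy_comp_swap (j : ℕ) (f : ℝ × ℝ → ℝ) :
    pdy^[j] (f ∘ Prod.swap) = pdx^[j] f ∘ Prod.swap := by
  induction j generalizing f with
  | zero => rfl
  | succ j ih => rw [Function.iterate_succ_apply, pdy_comp_swap, ih, Function.iterate_succ_apply]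

theorem lobatto_nodal_eval_eq_zero {r : ℕ} {L : ℕ → ℝ} (hL : IsLobattoPoints r L) {k : ℕ}
    (hk : k ≤ r) : ((X ^ 2 - 1) * derivative (Leg r)).eval (L k) = 0 := by
  obtain ⟨h0, hr, -, h⟩ := hL
  rcases Nat.eq_zero_or_pos k with rfl | hk0
  · simp [h0]
  · rcases hk.eq_or_lt with rfl | hk1
    · simp [hr]
    · have := (h k hk0 hk1).2
      rw [IsRoot] at this
      simp [this]

theorem lobatto_mem_Icc {r : ℕ} {L : ℕ → ℝ} (hL : IsLobattoPoints r L) {k : ℕ}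
    (hk : k ≤ r) : L k ∈ Set.Icc (-1 : ℝ) 1 := by
  obtain ⟨h0, hr, -, h⟩ := hL
  rcases Nat.eq_zero_or_pos k with rfl | hk0
  · simp [h0]
  · rcases hk.eq_or_lt with rfl | hk1
    · simp [hr]
    · exact Set.Ioo_subset_Icc_self (h k hk0 hk1).1

theorem affine_mem_Icc {A B s : ℝ} (hAB : A ≤ B) (hs : s ∈ Set.Icc (-1 : ℝ) 1) :
    (A + B + (B - A) * s) / 2 ∈ Set.Icc A B := by
  have h : 0 ≤ B - A := by linarith
  constructor <;> nlinarith [mul_le_mul_of_nonneg_left hs.1 h, mul_le_mul_of_nonneg_left hs.2 h]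

/-- Derivative of the one-dimensional Lobatto interpolation error at a Gauss point. -/
theorem abs_deriv_lobatto_error_le {r : ℕ} (hr : 1 ≤ r) {G L : ℕ → ℝ} (hG : IsGaussPoints r G)
    (hL : IsLobattoPoints r L) {A B : ℝ} (hAB : A < B) {φ : ℝ → ℝ}
    (hφ : ContDiff ℝ (r + 2 : ℕ) φ) {p : ℝ[X]} (hp : p.natDegree ≤ r)
    (hint : ∀ k ≤ r, φ ((A + B + (B - A) * L k) / 2) = p.eval ((A + B + (B - A) * L k) / 2))
    {k : ℕ} (hk : k ∈ Finset.Icc 1 r) :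
    |deriv φ ((A + B + (B - A) * G k) / 2) -
        (derivative p).eval ((A + B + (B - A) * G k) / 2)| ≤
      (B - A) ^ r * ∫ t in A..B, |iteratedDeriv (r + 2) φ t| := by
  obtain ⟨κ, hκ, hM⟩ := iterate_derivative_lobatto_nodal r hr
  rw [Finset.mem_Icc] at hk
  obtain ⟨hGk, hroot⟩ := hG.2 k hk.1 hk.2
  have hh : B - A ≠ 0 := by linarith
  set M : ℝ[X] := (X ^ 2 - 1) * derivative (Leg r) with hMdef
  set ω : ℝ[X] := M.comp (C (2 / (B - A)) * X + C (-(A + B) / (B - A))) with hω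
  have hinv : ∀ s, 2 / (B - A) * ((A + B + (B - A) * s) / 2) + -(A + B) / (B - A) = s := by
    intro s; field_simp; ring
  refine abs_deriv_sub_eval_le_of_interp (z := fun k => (A + B + (B - A) * L k) / 2) (ω := ω)
    (κ := (2 / (B - A)) ^ (r + 1) * κ) ?_ (fun k hk => affine_mem_Icc hAB.le (lobatto_mem_Icc hL hk))
    hφ hp hint ?_ ?_ ?_ (affine_mem_Icc hAB.le (Set.Ioo_subset_Icc_self hGk)) ?_
  · intro k hk
    have := hL.2.2.1 k hk
    have h := mul_lt_mul_of_pos_left this (sub_pos.2 hAB)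
    linarith
  · positivity
  · rw [hω, iterate_derivative_comp_affine, hM]; simp
  · intro k hk
    rw [hω, eval_comp]
    simp only [eval_add, eval_mul, eval_C, eval_X, hinv]
    exact lobatto_nodal_eval_eq_zero hL hk
  · rw [hω, derivative_comp, hMdef, derivative_lobatto_nodal, eval_mul, eval_comp]
    simp only [eval_add, eval_mul, eval_C, eval_X, hinv]
    rw [hroot]; simp

/-- Scaled inverse-type estimate on `[A, B]`. -/
theorem exists_derivative_eval_bound_Icc {r : ℕ} {L : ℕ → ℝ} (hL : ∀ k < r, L k < L (k + 1))
    (G : ℕ → ℝ) :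
    ∃ K : ℝ, 0 ≤ K ∧ ∀ A B : ℝ, A < B → ∀ (D : ℝ[X]) (M : ℝ), D.natDegree ≤ r →
      (∀ k ≤ r, |D.eval ((A + B + (B - A) * L k) / 2) -
        D.eval ((A + B + (B - A) * L 0) / 2)| ≤ M) →
      ∀ k ∈ Finset.Icc 1 r,
        |(derivative D).eval ((A + B + (B - A) * G k) / 2)| ≤ K / (B - A) * M := by
  obtain ⟨K, hK, h⟩ := exists_derivative_eval_bound hL G
  refine ⟨2 * K, by positivity, fun A B hAB D M hD hM k hk => ?_⟩
  have hh : 0 < B - A := sub_pos.2 hAB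
  have haff : ∀ s, (B - A) / 2 * s + (A + B) / 2 = (A + B + (B - A) * s) / 2 := fun s => by ring
  have h1 := h (D.comp (C ((B - A) / 2) * X + C ((A + B) / 2))) M
    (by
      rw [natDegree_comp]
      calc D.natDegree * _ ≤ D.natDegree * 1 := Nat.mul_le_mul_left _ natDegree_linear_le
        _ ≤ r := by omega)
    (by simpa only [eval_comp, eval_add, eval_mul, eval_C, eval_X, haff] using hM) k hk
  rw [derivative_comp] at h1
  simp only [eval_comp, eval_mul, eval_add, eval_C, eval_X, haff, derivative_add, derivative_mul,
    derivative_C, derivative_X, zero_mul, zero_add, mul_one, add_zero, abs_mul,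
    abs_of_pos (half_pos hh)] at h1
  rw [div_mul_eq_mul_div, le_div_iff₀ hh]
  linarith

theorem continuous_integral_abs_section {F : ℝ × ℝ → ℝ} (hF : Continuous F) (x₀ x₁ : ℝ) :
    Continuous fun t => ∫ x in x₀..x₁, |F (x, t)| :=
  intervalIntegral.continuous_parametric_intervalIntegral_of_continuous'
    (f := fun t x => |F (x, t)|) (by fun_prop) x₀ x₁

/-- The difference of two horizontal sections is bounded by the integral of `|∂F/∂x|`. -/
theorem abs_sub_section_le {F : ℝ × ℝ → ℝ} (hF : ContDiff ℝ 1 F) {x₀ x₁ a b : ℝ}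
    (ha : a ∈ Set.Icc x₀ x₁) (hb : b ∈ Set.Icc x₀ x₁) (t : ℝ) :
    |F (b, t) - F (a, t)| ≤ ∫ x in x₀..x₁, |pdx F (x, t)| := by
  have hc : Continuous (pdx F) := (contDiff_pdx (n := 0) hF).continuous
  have hct : Continuous fun x => pdx F (x, t) := by fun_prop
  have hftc : ∫ x in a..b, pdx F (x, t) = F (b, t) - F (a, t) :=
    intervalIntegral.integral_eq_sub_of_hasDerivAt
      (f := fun x => F (x, t))
      (fun x _ => hasDerivAt_section_fst (hF.differentiable (by simp)) x t)
      (hct.intervalIntegrable _ _)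
  rw [← hftc, intervalIntegral.integral_of_le (ha.1.trans ha.2)]
  refine (intervalIntegral.norm_integral_le_integral_norm_uIoc
    (f := fun x => pdx F (x, t))).trans ?_
  refine setIntegral_mono_set hct.abs.integrableOn_Ioc
    (Filter.Eventually.of_forall fun t => abs_nonneg _) (LE.le.eventuallyLE ?_)
  rintro s ⟨h2, h3⟩
  exact ⟨(le_min ha.1 hb.1).trans_lt h2, h3.trans (max_le ha.2 hb.2)⟩

/-- Estimate of `∂(f - v)/∂x` along a vertical Gauss line of the cell `[x₀, x₁] × [y₀, y₁]`, when
`v` is the Lobatto interpolant of `f` on that cell. -/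
theorem exists_gauss_line_bound {r : ℕ} (hr : 1 ≤ r) {G L : ℕ → ℝ} (hG : IsGaussPoints r G)
    (hL : IsLobattoPoints r L) :
    ∃ K : ℝ, 0 ≤ K ∧ ∀ x₀ x₁ y₀ y₁ : ℝ, x₀ < x₁ → y₀ < y₁ → ∀ f v : ℝ × ℝ → ℝ,
      ContDiff ℝ (r + 2 : ℕ) f → ContDiff ℝ 1 v →
      (∀ y, ∃ p : ℝ[X], p.natDegree ≤ r ∧ ∀ x, v (x, y) = p.eval x) →
      (∀ x, ∃ p : ℝ[X], p.natDegree ≤ r ∧ ∀ y, v (x, y) = p.eval y) →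
      (∀ k ≤ r, ∀ l ≤ r,
        v ((x₀ + x₁ + (x₁ - x₀) * L k) / 2, (y₀ + y₁ + (y₁ - y₀) * L l) / 2) =
        f ((x₀ + x₁ + (x₁ - x₀) * L k) / 2, (y₀ + y₁ + (y₁ - y₀) * L l) / 2)) →
      ∀ k ∈ Finset.Icc 1 r,
        ∫ t in y₀..y₁, |pdx (fun z => f z - v z) ((x₀ + x₁ + (x₁ - x₀) * G k) / 2, t)| ≤
          (x₁ - x₀) ^ r * (∫ t in y₀..y₁, ∫ x in x₀..x₁, |pdx^[r + 2] f (x, t)|) +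
          K / (x₁ - x₀) * (y₁ - y₀) ^ (r + 1) *
            ∫ t in y₀..y₁, ∫ x in x₀..x₁, |pdx (pdy^[r + 1] f) (x, t)| := by
  obtain ⟨K, hK, hKb⟩ := exists_derivative_eval_bound_Icc hL.2.2.1 G
  refine ⟨K, hK, fun x₀ x₁ y₀ y₁ hx hy f v hf hv hvx hvy hint k hk => ?_⟩
  set zx : ℕ → ℝ := fun k => (x₀ + x₁ + (x₁ - x₀) * L k) / 2 with hzx
  set zy : ℕ → ℝ := fun k => (y₀ + y₁ + (y₁ - y₀) * L k) / 2 with hzy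
  set g : ℝ := (x₀ + x₁ + (x₁ - x₀) * G k) / 2 with hg
  have hzxlt : ∀ k < r, zx k < zx (k + 1) := fun k hk => by
    have h := mul_lt_mul_of_pos_left (hL.2.2.1 k hk) (sub_pos.2 hx)
    simp only [hzx]; linarith
  have hzylt : ∀ k < r, zy k < zy (k + 1) := fun k hk => by
    have h := mul_lt_mul_of_pos_left (hL.2.2.1 k hk) (sub_pos.2 hy)
    simp only [hzy]; linarith
  have hzxm : ∀ k ≤ r, zx k ∈ Set.Icc x₀ x₁ := fun k hk =>
    affine_mem_Icc hx.le (lobatto_mem_Icc hL hk)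
  have hzym : ∀ k ≤ r, zy k ∈ Set.Icc y₀ y₁ := fun k hk =>
    affine_mem_Icc hy.le (lobatto_mem_Icc hL hk)
  set F₁ : ℝ × ℝ → ℝ := pdx^[r + 2] f with hF₁
  set F₂ : ℝ × ℝ → ℝ := pdy^[r + 1] f with hF₂
  have hF₁c : Continuous F₁ :=
    (contDiff_iterate_pdx (r + 2) (n := 0) (by simpa using hf)).continuous
  have hF₂c : ContDiff ℝ 1 F₂ :=
    contDiff_iterate_pdy (r + 1) (n := 1) (by convert hf using 2; omega)
  have hF₂d : Continuous (pdx F₂) := (contDiff_pdx (n := 0) hF₂c).continuous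
  set J : ℝ := ∫ t in y₀..y₁, ∫ x in x₀..x₁, |pdx F₂ (x, t)| with hJ
  have hosc : ∀ t ∈ Set.Icc y₀ y₁, ∀ k ≤ r,
      |(f (zx k, t) - v (zx k, t)) - (f (zx 0, t) - v (zx 0, t))| ≤ (y₁ - y₀) ^ r * J := by
    intro t ht k hk
    obtain ⟨pk, hpk, hpkv⟩ := hvy (zx k)
    obtain ⟨p0, hp0, hp0v⟩ := hvy (zx 0)
    have hsec : ∀ x, ContDiff ℝ (r + 1 : ℕ) fun s => f (x, s) := fun x =>
      (hf.of_le (by exact_mod_cast (by omega : r + 1 ≤ r + 2))).comp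
        (contDiff_const.prodMk contDiff_id)
    have h := abs_sub_eval_le_of_interp hzylt hzym (φ := fun s => f (zx k, s) - f (zx 0, s))
      ((hsec _).sub (hsec _)) (p := pk - p0)
      ((natDegree_sub_le _ _).trans (max_le hpk hp0))
      (fun l hl => by
        rw [eval_sub, ← hpkv, ← hp0v, hint k hk l hl, hint 0 (Nat.zero_le r) l hl]) ht
    rw [eval_sub, ← hpkv, ← hp0v] at h
    have hder : ∀ s, iteratedDeriv (r + 1) (fun s => f (zx k, s) - f (zx 0, s)) s =
        F₂ (zx k, s) - F₂ (zx 0, s) := by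
      intro s
      have hf1 : ContDiff ℝ (r + 1 : ℕ) f :=
        hf.of_le (by exact_mod_cast (by omega : r + 1 ≤ r + 2))
      rw [iteratedDeriv_fun_sub (hsec _).contDiffAt (hsec _).contDiffAt,
        iteratedDeriv_section_snd _ hf1, iteratedDeriv_section_snd _ hf1]
    simp only [hder] at h
    calc |(f (zx k, t) - v (zx k, t)) - (f (zx 0, t) - v (zx 0, t))|
        = |f (zx k, t) - f (zx 0, t) - (v (zx k, t) - v (zx 0, t))| := by congr 1; ring
      _ ≤ _ := h
      _ ≤ (y₁ - y₀) ^ r * J := by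
        refine mul_le_mul_of_nonneg_left ?_ (pow_nonneg (sub_pos.2 hy).le r)
        refine intervalIntegral.integral_mono_on hy.le ?_ ?_ fun s _ =>
          abs_sub_section_le hF₂c (hzxm 0 (Nat.zero_le r)) (hzxm k hk) s
        · have := hF₂c.continuous
          exact Continuous.intervalIntegrable (by fun_prop) _ _
        · exact (continuous_integral_abs_section hF₂d _ _).intervalIntegrable _ _
  have hpt : ∀ t ∈ Set.Icc y₀ y₁, |pdx (fun z => f z - v z) (g, t)| ≤
      (x₁ - x₀) ^ r * (∫ x in x₀..x₁, |F₁ (x, t)|) + K / (x₁ - x₀) * ((y₁ - y₀) ^ r * J) := by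
    intro t ht
    obtain ⟨p, hp, hpv⟩ := hvx t
    have hinj := injOn_range_of_lt_succ hzxlt
    set q : ℝ[X] := Lagrange.interpolate (Finset.range (r + 1)) zx fun k => f (zx k, t) with hq
    have hqdeg : q.natDegree ≤ r := by
      have h := Lagrange.degree_interpolate_lt (fun k => f (zx k, t)) hinj
      rw [Finset.card_range] at h
      exact natDegree_le_iff_degree_le.2 (Order.le_of_lt_succ (by exact_mod_cast h))
    have hqe : ∀ k ≤ r, q.eval (zx k) = f (zx k, t) := fun k hk =>
      Lagrange.eval_interpolate_at_node _ hinj (by simpa using Nat.lt_succ_of_le hk)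
    have hfd : Differentiable ℝ f := hf.differentiable (by simp)
    have hvd : Differentiable ℝ v := hv.differentiable (by simp)
    have hsec : ContDiff ℝ (r + 2 : ℕ) fun s => f (s, t) :=
      hf.comp (contDiff_id.prodMk contDiff_const)
    have h1 := abs_deriv_lobatto_error_le hr hG hL hx hsec hqdeg
      (fun k hk => (hqe k hk).symm) hk
    rw [iteratedDeriv_section_fst _ hf] at h1
    have h2 := hKb x₀ x₁ hx (q - p) ((y₁ - y₀) ^ r * J)
      ((natDegree_sub_le _ _).trans (max_le hqdeg hp))
      (fun k hk => by
        have := hosc t ht k hk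
        rw [hpv, hpv, ← hqe k hk, ← hqe 0 (Nat.zero_le r)] at this
        rw [eval_sub, eval_sub]
        exact this) k hk
    have hval : pdx (fun z => f z - v z) (g, t) =
        (deriv (fun s => f (s, t)) g - (derivative q).eval g) + (derivative (q - p)).eval g := by
      have hd := (hasDerivAt_section_fst (hfd.sub hvd) g t).deriv
      have hvp : (fun s => v (s, t)) = fun s => p.eval s := funext hpv
      have hdv := (hasDerivAt_section_fst hvd g t).deriv
      rw [hvp, Polynomial.deriv] at hdv
      have hdf := (hasDerivAt_section_fst hfd g t).deriv
      rw [hdf, derivative_sub, eval_sub, hdv]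
      have hs : pdx (fun z => f z - v z) (g, t) = pdx f (g, t) - pdx v (g, t) := by
        simp only [pdx]
        rw [fderiv_fun_sub (hfd _) (hvd _)]
        rfl
      rw [hs]; ring
    rw [hval]
    exact (abs_add_le _ _).trans (add_le_add h1 h2)
  have hec : Continuous fun t => |pdx (fun z => f z - v z) (g, t)| := by
    have : Continuous (pdx fun z => f z - v z) :=
      (contDiff_pdx (n := 0) ((hf.of_le (by exact_mod_cast (by omega : 0 + 1 ≤ r + 2))).sub hv)).continuous
    fun_prop
  have hI := continuous_integral_abs_section hF₁c x₀ x₁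
  calc ∫ t in y₀..y₁, |pdx (fun z => f z - v z) (g, t)|
      ≤ ∫ t in y₀..y₁, ((x₁ - x₀) ^ r * (∫ x in x₀..x₁, |F₁ (x, t)|) +
          K / (x₁ - x₀) * ((y₁ - y₀) ^ r * J)) :=
        intervalIntegral.integral_mono_on hy.le (hec.intervalIntegrable _ _)
          (Continuous.intervalIntegrable (by fun_prop) _ _) hpt
    _ = _ := by
        rw [intervalIntegral.integral_add (Continuous.intervalIntegrable (by fun_prop) _ _)
          (Continuous.intervalIntegrable (by fun_prop) _ _), intervalIntegral.integral_const_mul,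
          intervalIntegral.integral_const, smul_eq_mul]
        ring

/-- Cauchy–Schwarz on a set of finite measure. -/
theorem setIntegral_abs_le_sqrt {S : Set (ℝ × ℝ)} (hS : IsCompact S) {F : ℝ × ℝ → ℝ}
    (hF : Continuous F) :
    ∫ z in S, |F z| ≤ √(volume.real S) * √(∫ z in S, F z ^ 2) := by
  have h1 : IntegrableOn (fun z => |F z|) S := hF.abs.continuousOn.integrableOn_compact hS
  have h2 : IntegrableOn (fun z => F z ^ 2) S := (hF.pow 2).continuousOn.integrableOn_compact hS
  have hc : ∀ c : ℝ, IntegrableOn (fun _ => c) S := fun c =>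
    continuousOn_const.integrableOn_compact hS
  set V := volume.real S with hV
  set I := ∫ z in S, |F z| with hI
  set Q := ∫ z in S, F z ^ 2 with hQ
  have hI0 : 0 ≤ I := integral_nonneg fun z => abs_nonneg _
  have hV0 : 0 ≤ V := measureReal_nonneg
  have hquad : ∀ s : ℝ, 0 ≤ V * (s * s) + (-2 * I) * s + Q := by
    intro s
    have h : 0 ≤ ∫ z in S, (s ^ 2 - 2 * s * |F z| + F z ^ 2) := by
      refine integral_nonneg fun z => ?_
      have : s ^ 2 - 2 * s * |F z| + F z ^ 2 = (s - |F z|) ^ 2 := by rw [← sq_abs (F z)]; ring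
      simp only [this]; positivity
    have h3 : IntegrableOn (fun z => s ^ 2 - 2 * s * |F z|) S :=
      (hc (s ^ 2)).sub (h1.const_mul (2 * s))
    rw [integral_add h3 h2,
      integral_sub (hc _) (h1.const_mul _),
      integral_const_mul, setIntegral_const, smul_eq_mul] at h
    linarith
  have hdisc := discrim_le_zero hquad
  rw [← Real.sqrt_mul hV0]
  refine Real.le_sqrt_of_sq_le ?_
  rw [discrim] at hdisc
  nlinarith

theorem integral_integral_abs_eq {F : ℝ × ℝ → ℝ} (hF : Continuous F) {x₀ x₁ y₀ y₁ : ℝ}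
    (hx : x₀ ≤ x₁) (hy : y₀ ≤ y₁) :
    (∫ x in x₀..x₁, ∫ t in y₀..y₁, |F (x, t)|) =
      ∫ z in Set.Icc x₀ x₁ ×ˢ Set.Icc y₀ y₁, |F z| := by
  rw [Measure.volume_eq_prod, setIntegral_prod]
  · simp_rw [intervalIntegral.integral_of_le hx, intervalIntegral.integral_of_le hy,
      integral_Icc_eq_integral_Ioc]
  · exact hF.abs.continuousOn.integrableOn_compact (isCompact_Icc.prod isCompact_Icc)

theorem integral_integral_abs_le {F : ℝ × ℝ → ℝ} (hF : Continuous F) {x₀ x₁ y₀ y₁ h : ℝ}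
    (hx : x₀ ≤ x₁) (hy : y₀ ≤ y₁) (hxh : x₁ - x₀ ≤ h) (hyh : y₁ - y₀ ≤ h) :
    (∫ x in x₀..x₁, ∫ t in y₀..y₁, |F (x, t)|) ≤
      h * √(∫ z in Set.Icc x₀ x₁ ×ˢ Set.Icc y₀ y₁, F z ^ 2) := by
  rw [integral_integral_abs_eq hF hx hy]
  refine (setIntegral_abs_le_sqrt (isCompact_Icc.prod isCompact_Icc) hF).trans ?_
  refine mul_le_mul_of_nonneg_right ?_ (Real.sqrt_nonneg _)
  rw [Measure.volume_eq_prod, measureReal_prod_prod, Real.volume_real_Icc_of_le hx,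
    Real.volume_real_Icc_of_le hy]
  refine Real.sqrt_le_iff.2 ⟨by linarith, ?_⟩
  nlinarith

theorem integral_integral_abs_swap {F : ℝ × ℝ → ℝ} (hF : Continuous F) (x₀ x₁ y₀ y₁ : ℝ) :
    (∫ t in y₀..y₁, ∫ x in x₀..x₁, |F (x, t)|) = ∫ x in x₀..x₁, ∫ t in y₀..y₁, |F (x, t)| := by
  refine intervalIntegral_intervalIntegral_swap (F := fun t x => |F (x, t)|) ?_
  have hc : Continuous (Function.uncurry fun t x => |F (x, t)|) := by
    simp only [Function.uncurry_def]; fun_prop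
  exact (hc.continuousOn.integrableOn_compact (isCompact_uIcc.prod isCompact_uIcc)).mono_set
    (Set.prod_mono Set.uIoc_subset_uIcc Set.uIoc_subset_uIcc)

/-- Flux bound along a segment inside `[y₀, y₁]`. -/
theorem abs_integral_mul_le {α φ : ℝ → ℝ} {αM y₀ y₁ s t : ℝ} (hφ : Continuous φ)
    (hα : ∀ τ ∈ Set.Icc y₀ y₁, |α τ| ≤ αM) (hs : s ∈ Set.Icc y₀ y₁) (ht : t ∈ Set.Icc y₀ y₁) :
    |∫ τ in s..t, α τ * φ τ| ≤ αM * ∫ τ in y₀..y₁, |φ τ| := by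
  have hαM : 0 ≤ αM := (abs_nonneg _).trans (hα s hs)
  have hsub : Set.uIoc s t ⊆ Set.Ioc y₀ y₁ := by
    rintro τ ⟨h2, h3⟩
    exact ⟨(le_min hs.1 ht.1).trans_lt h2, h3.trans (max_le hs.2 ht.2)⟩
  have hint : IntegrableOn (fun τ => αM * |φ τ|) (Set.Ioc y₀ y₁) :=
    Continuous.integrableOn_Ioc (by fun_prop)
  rw [← intervalIntegral.integral_const_mul, intervalIntegral.integral_of_le (hs.1.trans hs.2)]
  refine (intervalIntegral.norm_integral_le_integral_norm_uIoc (f := fun τ => α τ * φ τ)).trans ?_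
  refine (integral_mono_of_nonneg (Filter.Eventually.of_forall fun τ => norm_nonneg _)
    (hint.mono_set hsub) ?_).trans
    (setIntegral_mono_set hint (Filter.Eventually.of_forall fun τ => by positivity)
      (LE.le.eventuallyLE hsub))
  refine ae_restrict_of_forall_mem measurableSet_uIoc fun τ hτ => ?_
  simp only [Real.norm_eq_abs, abs_mul]
  exact mul_le_mul_of_nonneg_right (hα τ (Set.Ioc_subset_Icc_self (hsub hτ))) (abs_nonneg _)

theorem sum_shift_le (n : ℕ) {φ : ℕ → ℝ} (hφ : ∀ j, 0 ≤ φ j) :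
    ∑ j ∈ Finset.Icc 1 n, (if j < n then φ (j + 1) else 0) ≤ ∑ j ∈ Finset.Icc 1 n, φ j := by
  rw [← Finset.sum_filter,
    ← Finset.sum_image (f := φ) (g := fun j => j + 1) fun _ _ _ _ h => Nat.succ_injective h]
  refine Finset.sum_le_sum_of_subset_of_nonneg ?_ fun j _ _ => hφ j
  intro j hj
  simp only [Finset.mem_image, Finset.mem_filter, Finset.mem_Icc] at hj ⊢
  omega

namespace RectPartition

variable {a b c d : ℝ}

/-- The partition with the two coordinates exchanged. -/
def swap (P : RectPartition a b c d) : RectPartition c d a b where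
  m := P.n
  n := P.m
  hm := P.hn
  hn := P.hm
  x := P.y
  y := P.x
  hxa := P.hyc
  hxb := P.hyd
  hyc := P.hxa
  hyd := P.hxb
  hxlt := P.hylt
  hylt := P.hxlt

variable (P : RectPartition a b c d)

theorem x_le {i k : ℕ} (hik : i ≤ k) (hk : k ≤ P.m) : P.x i ≤ P.x k := by
  induction k, hik using Nat.le_induction with
  | base => exact le_rfl
  | succ k hk' ih => exact (ih (by omega)).trans (P.hxlt k (by omega)).le

theorem x_pred_lt {i : ℕ} (hi : i ∈ Finset.Icc 1 P.m) : P.x (i - 1) < P.x i := by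
  rw [Finset.mem_Icc] at hi
  have h := P.hxlt (i - 1) (by omega)
  rwa [Nat.sub_add_cancel hi.1] at h

theorem y_pred_lt {j : ℕ} (hj : j ∈ Finset.Icc 1 P.n) : P.y (j - 1) < P.y j :=
  P.swap.x_pred_lt hj

theorem Icc_x_subset {i : ℕ} (hi : i ∈ Finset.Icc 1 P.m) :
    Set.Icc (P.x (i - 1)) (P.x i) ⊆ Set.Icc a b := by
  rw [Finset.mem_Icc] at hi
  have h1 := P.x_le (Nat.zero_le (i - 1)) (by omega)
  have h2 := P.x_le hi.2 le_rfl
  rw [P.hxa] at h1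
  rw [P.hxb] at h2
  exact Set.Icc_subset_Icc h1 h2

theorem Icc_y_subset {j : ℕ} (hj : j ∈ Finset.Icc 1 P.n) :
    Set.Icc (P.y (j - 1)) (P.y j) ⊆ Set.Icc c d :=
  P.swap.Icc_x_subset hj

theorem gx_eq (r : ℕ) (G : ℕ → ℝ) (i : ℕ) {k : ℕ} (hk : k ≤ r) :
    P.gx r G i k = (P.x (i - 1) + P.x i + (P.x i - P.x (i - 1)) * G k) / 2 := by
  rw [gx, if_neg (by omega), hx, add_comm (P.x i)]

theorem gx_mem {r : ℕ} {G : ℕ → ℝ} (hG : IsGaussPoints r G) {i k : ℕ}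
    (hi : i ∈ Finset.Icc 1 P.m) (hk : k ∈ Finset.Icc 1 r) :
    P.gx r G i k ∈ Set.Icc (P.x (i - 1)) (P.x i) := by
  rw [Finset.mem_Icc] at hk
  rw [P.gx_eq r G i hk.2]
  exact affine_mem_Icc (P.x_pred_lt hi).le (Set.Ioo_subset_Icc_self (hG.2 k hk.1 hk.2).1)

theorem gx_last {r : ℕ} {G : ℕ → ℝ} (hr : 1 ≤ r) {i : ℕ} (hi : i < P.m) :
    P.gx r G i (r + 1) = P.gx r G (i + 1) 1 := by
  rw [gx, if_pos rfl, if_neg hi.ne, gx, if_neg (by omega)]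
  simp

theorem gy_mem {r : ℕ} {G : ℕ → ℝ} (hG : IsGaussPoints r G) {j l : ℕ}
    (hj : j ∈ Finset.Icc 1 P.n) (hl : l ∈ Finset.Icc 1 r) :
    P.gy r G j l ∈ Set.Icc (P.y (j - 1)) (P.y j) :=
  P.swap.gx_mem hG hj hl

theorem gy_last {r : ℕ} {G : ℕ → ℝ} (hr : 1 ≤ r) {j : ℕ} (hj : j < P.n) :
    P.gy r G j (r + 1) = P.gy r G (j + 1) 1 :=
  P.swap.gx_last hr hj

/-- Flux integral of `D` across one Gauss segment, bounded cell by cell. -/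
theorem abs_flux_le {r : ℕ} (hr : 1 ≤ r) {G : ℕ → ℝ} (hG : IsGaussPoints r G) {α : ℝ × ℝ → ℝ}
    {αM : ℝ} (hα : ∀ z ∈ P.dom, |α z| ≤ αM) {D : ℕ → ℕ → ℝ × ℝ → ℝ}
    (hD : ∀ i ∈ Finset.Icc 1 P.m, ∀ j ∈ Finset.Icc 1 P.n, Continuous (D i j))
    {S : ℕ → ℕ → ℝ} {B : ℝ}
    (hB : ∀ i ∈ Finset.Icc 1 P.m, ∀ j ∈ Finset.Icc 1 P.n, ∀ k ∈ Finset.Icc 1 r,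
      ∫ t in (P.y (j - 1))..(P.y j), |D i j (P.gx r G i k, t)| ≤ B * S i j)
    {i k j l : ℕ} (hi : i ∈ Finset.Icc 1 P.m) (hk : k ∈ Finset.Icc 1 r)
    (hj : j ∈ Finset.Icc 1 P.n) (hl : l ∈ Finset.Icc 1 r) (hjl : ¬(j = P.n ∧ l = r)) :
    |(∫ t in (P.gy r G j l)..(min (P.gy r G j (l + 1)) (P.y j)),
          α (P.gx r G i k, t) * D i j (P.gx r G i k, t)) +
       (∫ t in (P.y j)..(max (P.gy r G j (l + 1)) (P.y j)),
          α (P.gx r G i k, t) * D i (j + 1) (P.gx r G i k, t))| ≤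
      αM * B * (S i j + if j < P.n then S i (j + 1) else 0) := by
  set g := P.gx r G i k with hg
  have hgm : g ∈ Set.Icc a b := P.Icc_x_subset hi (P.gx_mem hG hi hk)
  have hαM : 0 ≤ αM :=
    (abs_nonneg _).trans (hα (g, P.y j) ⟨hgm, P.Icc_y_subset hj ⟨(P.y_pred_lt hj).le, le_rfl⟩⟩)
  have hαcell : ∀ j ∈ Finset.Icc 1 P.n, ∀ τ ∈ Set.Icc (P.y (j - 1)) (P.y j), |α (g, τ)| ≤ αM :=
    fun j hj τ hτ => hα _ ⟨hgm, P.Icc_y_subset hj hτ⟩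
  have hDc : ∀ j ∈ Finset.Icc 1 P.n, Continuous fun t => D i j (g, t) := fun j hj => by
    have := hD i hi j hj
    fun_prop
  have hl' := Finset.mem_Icc.1 hl
  have hj' := Finset.mem_Icc.1 hj
  have hylt := P.y_pred_lt hj
  have hnext : (l < r ∧ P.gy r G j (l + 1) ∈ Set.Icc (P.y (j - 1)) (P.y j)) ∨
      (j < P.n ∧ P.gy r G j (l + 1) ∈ Set.Icc (P.y j) (P.y (j + 1))) := by
    rcases hl'.2.lt_or_eq with h | h
    · exact Or.inl ⟨h, P.gy_mem hG hj (Finset.mem_Icc.2 ⟨by omega, h⟩)⟩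
    · have hjn : j < P.n := by omega
      refine Or.inr ⟨hjn, ?_⟩
      rw [h, P.gy_last hr hjn]
      have := P.gy_mem hG (j := j + 1) (l := 1) (Finset.mem_Icc.2 ⟨by omega, hjn⟩)
        (Finset.mem_Icc.2 ⟨le_rfl, hr⟩)
      simpa using this
  have hfirst : |∫ t in (P.gy r G j l)..(min (P.gy r G j (l + 1)) (P.y j)),
      α (g, t) * D i j (g, t)| ≤ αM * B * S i j := by
    refine (abs_integral_mul_le (α := fun t => α (g, t)) (hDc j hj) (hαcell j hj)
      (P.gy_mem hG hj hl) ⟨le_min ?_ hylt.le, min_le_right _ _⟩).trans ?_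
    · rcases hnext with h | h
      · exact h.2.1
      · exact hylt.le.trans h.2.1
    · rw [mul_assoc]
      exact mul_le_mul_of_nonneg_left (hB i hi j hj k hk) hαM
  have hsecond : |∫ t in (P.y j)..(max (P.gy r G j (l + 1)) (P.y j)),
      α (g, t) * D i (j + 1) (g, t)| ≤ αM * B * if j < P.n then S i (j + 1) else 0 := by
    by_cases hjn : j < P.n
    · have hj1 : j + 1 ∈ Finset.Icc 1 P.n := Finset.mem_Icc.2 ⟨by omega, hjn⟩
      have hlt := P.hylt j hjn
      have hle : P.gy r G j (l + 1) ≤ P.y (j + 1) := by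
        rcases hnext with h | h
        · exact h.2.2.trans hlt.le
        · exact h.2.2
      rw [if_pos hjn]
      refine (abs_integral_mul_le (α := fun t => α (g, t)) (y₀ := P.y (j + 1 - 1))
        (hDc _ hj1) (hαcell _ hj1) ⟨le_rfl, hlt.le⟩
        ⟨le_max_right _ _, max_le hle hlt.le⟩).trans ?_
      rw [mul_assoc]
      exact mul_le_mul_of_nonneg_left (hB i hi (j + 1) hj1 k hk) hαM
    · have hle : P.gy r G j (l + 1) ≤ P.y j := by
        rcases hnext with h | h
        · exact h.2.2
        · exact absurd h.1 hjn
      rw [max_eq_right hle, if_neg hjn]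
      simp
  rw [mul_add]
  exact (abs_add_le _ _).trans (add_le_add hfirst hsecond)

theorem sum_idxX_sq_le (r : ℕ) {S : ℕ → ℕ → ℝ} :
    ∑ q ∈ idxX r P, (S q.1 q.2.2.1 + if q.2.2.1 < P.n then S q.1 (q.2.2.1 + 1) else 0) ^ 2 ≤
      (2 * r) ^ 2 * ∑ i ∈ Finset.Icc 1 P.m, ∑ j ∈ Finset.Icc 1 P.n, S i j ^ 2 := by
  have hcell : ∀ i, ∑ j ∈ Finset.Icc 1 P.n, (S i j + if j < P.n then S i (j + 1) else 0) ^ 2 ≤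
      4 * ∑ j ∈ Finset.Icc 1 P.n, S i j ^ 2 := by
    intro i
    calc ∑ j ∈ Finset.Icc 1 P.n, (S i j + if j < P.n then S i (j + 1) else 0) ^ 2
        ≤ ∑ j ∈ Finset.Icc 1 P.n,
            (2 * S i j ^ 2 + 2 * if j < P.n then S i (j + 1) ^ 2 else 0) := by
          refine Finset.sum_le_sum fun j _ => ?_
          split_ifs
          · nlinarith [sq_nonneg (S i j - S i (j + 1))]
          · nlinarith [sq_nonneg (S i j)]
      _ ≤ _ := by
          rw [Finset.sum_add_distrib, ← Finset.mul_sum, ← Finset.mul_sum]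
          have := sum_shift_le P.n (φ := fun j => S i j ^ 2) fun j => sq_nonneg _
          linarith
  refine (Finset.sum_le_sum_of_subset_of_nonneg (Finset.filter_subset _ _)
    fun _ _ _ => sq_nonneg _).trans ?_
  simp only [Finset.sum_product, Finset.sum_const, Nat.card_Icc, Nat.add_sub_cancel,
    nsmul_eq_mul, ← Finset.mul_sum]
  calc (r : ℝ) * ((r : ℝ) * ∑ i ∈ Finset.Icc 1 P.m, ∑ j ∈ Finset.Icc 1 P.n,
        (S i j + if j < P.n then S i (j + 1) else 0) ^ 2)
      ≤ (r : ℝ) * ((r : ℝ) * ∑ i ∈ Finset.Icc 1 P.m, 4 * ∑ j ∈ Finset.Icc 1 P.n, S i j ^ 2) := by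
        gcongr with i _
        exact hcell i
    _ = _ := by rw [← Finset.mul_sum]; ring

/-- The `x`-flux part of the bilinear form, bounded by the cellwise line integrals. -/
theorem abs_sum_idxX_le {r : ℕ} (hr : 1 ≤ r) {G : ℕ → ℝ} (hG : IsGaussPoints r G)
    {α : ℝ × ℝ → ℝ} {αM : ℝ} (hα : ∀ z ∈ P.dom, |α z| ≤ αM) {D : ℕ → ℕ → ℝ × ℝ → ℝ}
    (hD : ∀ i ∈ Finset.Icc 1 P.m, ∀ j ∈ Finset.Icc 1 P.n, Continuous (D i j))
    {S : ℕ → ℕ → ℝ} {B : ℝ} (hαB : 0 ≤ αM * B)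
    (hB : ∀ i ∈ Finset.Icc 1 P.m, ∀ j ∈ Finset.Icc 1 P.n, ∀ k ∈ Finset.Icc 1 r,
      ∫ t in (P.y (j - 1))..(P.y j), |D i j (P.gx r G i k, t)| ≤ B * S i j)
    (w : ℕ → ℕ → ℕ → ℕ → ℝ) :
    |∑ q ∈ idxX r P, jumpX r w q.1 q.2.1 q.2.2.1 q.2.2.2 *
      ((∫ t in (P.gy r G q.2.2.1 q.2.2.2)..(min (P.gy r G q.2.2.1 (q.2.2.2 + 1)) (P.y q.2.2.1)),
          α (P.gx r G q.1 q.2.1, t) * D q.1 q.2.2.1 (P.gx r G q.1 q.2.1, t)) +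
       (∫ t in (P.y q.2.2.1)..(max (P.gy r G q.2.2.1 (q.2.2.2 + 1)) (P.y q.2.2.1)),
          α (P.gx r G q.1 q.2.1, t) * D q.1 (q.2.2.1 + 1) (P.gx r G q.1 q.2.1, t)))| ≤
      αM * B * (√(∑ q ∈ idxX r P, jumpX r w q.1 q.2.1 q.2.2.1 q.2.2.2 ^ 2) *
        (2 * r * √(∑ i ∈ Finset.Icc 1 P.m, ∑ j ∈ Finset.Icc 1 P.n, S i j ^ 2))) := by
  set T : ℕ × ℕ × ℕ × ℕ → ℝ := fun q =>
    S q.1 q.2.2.1 + if q.2.2.1 < P.n then S q.1 (q.2.2.1 + 1) else 0 with hT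
  set J : ℕ × ℕ × ℕ × ℕ → ℝ := fun q => jumpX r w q.1 q.2.1 q.2.2.1 q.2.2.2 with hJ
  calc _ ≤ ∑ q ∈ idxX r P, |J q| * (αM * B * T q) := by
        refine (Finset.abs_sum_le_sum_abs _ _).trans (Finset.sum_le_sum fun q hq => ?_)
        simp only [idxX, Finset.mem_filter, Finset.mem_product] at hq
        obtain ⟨⟨hi, hk, hj, hl⟩, hjl⟩ := hq
        rw [abs_mul]
        exact mul_le_mul_of_nonneg_left (P.abs_flux_le hr hG hα hD hB hi hk hj hl hjl)
          (abs_nonneg _)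
    _ = αM * B * ∑ q ∈ idxX r P, |J q| * T q := by
        rw [Finset.mul_sum]
        exact Finset.sum_congr rfl fun q _ => by ring
    _ ≤ αM * B * (√(∑ q ∈ idxX r P, |J q| ^ 2) * √(∑ q ∈ idxX r P, T q ^ 2)) :=
        mul_le_mul_of_nonneg_left (Real.sum_mul_le_sqrt_mul_sqrt _ _ _) hαB
    _ ≤ _ := by
        simp only [sq_abs]
        refine mul_le_mul_of_nonneg_left (mul_le_mul_of_nonneg_left ?_ (Real.sqrt_nonneg _)) hαB
        have h2r : (0 : ℝ) ≤ 2 * r := by positivity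
        rw [← Real.sqrt_sq h2r, ← Real.sqrt_mul (sq_nonneg _)]
        exact Real.sqrt_le_sqrt (P.sum_idxX_sq_le r)

theorem sum_idxY_eq (r : ℕ) (F : ℕ → ℕ → ℕ → ℕ → ℝ) :
    ∑ q ∈ idxY r P, F q.1 q.2.1 q.2.2.1 q.2.2.2 =
      ∑ q ∈ idxX r P.swap, F q.2.2.1 q.2.2.2 q.1 q.2.1 := by
  refine Finset.sum_nbij' (fun q => (q.2.2.1, q.2.2.2, q.1, q.2.1))
    (fun q => (q.2.2.1, q.2.2.2, q.1, q.2.1)) ?_ ?_ ?_ ?_ ?_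
  · intro q hq
    rw [idxY, Finset.mem_filter] at hq
    rw [idxX, Finset.mem_filter]
    simp only [Finset.mem_product] at hq ⊢
    exact ⟨⟨hq.1.2.2.1, hq.1.2.2.2, hq.1.1, hq.1.2.1⟩, hq.2⟩
  · intro q hq
    rw [idxX, Finset.mem_filter] at hq
    rw [idxY, Finset.mem_filter]
    simp only [Finset.mem_product] at hq ⊢
    exact ⟨⟨hq.1.2.2.1, hq.1.2.2.2, hq.1.1, hq.1.2.1⟩, hq.2⟩
  · intro q _; rfl
  · intro q _; rfl
  · intro q _; rfl

theorem hx_le_meshSize {i : ℕ} (hi : i ∈ Finset.Icc 1 P.m) : P.hx i ≤ P.meshSize :=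
  Finset.le_max' _ _ (Finset.mem_union_left _ (Finset.mem_image_of_mem _ hi))

theorem hy_le_meshSize {j : ℕ} (hj : j ∈ Finset.Icc 1 P.n) : P.hy j ≤ P.meshSize :=
  Finset.le_max' _ _ (Finset.mem_union_right _ (Finset.mem_image_of_mem _ hj))

theorem meshSize_le_mul_hx {σ : ℝ} (hP : P.QuasiUniform σ) {i : ℕ} (hi : i ∈ Finset.Icc 1 P.m) :
    P.meshSize ≤ σ * P.hx i :=
  hP _ (Finset.max'_mem _ _) _ (Finset.mem_union_left _ (Finset.mem_image_of_mem _ hi))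

theorem meshSize_le_mul_hy {σ : ℝ} (hP : P.QuasiUniform σ) {j : ℕ} (hj : j ∈ Finset.Icc 1 P.n) :
    P.meshSize ≤ σ * P.hy j :=
  hP _ (Finset.max'_mem _ _) _ (Finset.mem_union_right _ (Finset.mem_image_of_mem _ hj))

end RectPartition

theorem wE_swap (r : ℕ) (w : ℕ → ℕ → ℕ → ℕ → ℝ) (i k j l : ℕ) :
    wE r (fun j l i k => w i k j l) j l i k = wE r w i k j l := by
  simp only [wE, or_comm]

theorem jumpX_swap (r : ℕ) (w : ℕ → ℕ → ℕ → ℕ → ℝ) (i k j l : ℕ) :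
    jumpX r (fun j l i k => w i k j l) j l i k = jumpY r w i k j l := by
  simp only [jumpX, jumpY, wE_swap]

theorem evalXY_eq_sum (p : ℝ[X][X]) (x y : ℝ) :
    evalXY p x y = ∑ k ∈ Finset.range (p.natDegree + 1), (p.coeff k).eval y * x ^ k := by
  rw [evalXY, eval_map, eval₂_eq_sum_range]
  simp

theorem IsBiPoly.contDiff {r : ℕ} {f : ℝ × ℝ → ℝ} (hf : IsBiPoly r f) : ContDiff ℝ 1 f := by
  obtain ⟨p, -, -, h⟩ := hf
  have hfun : f = fun z : ℝ × ℝ =>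
      ∑ k ∈ Finset.range (p.natDegree + 1), (p.coeff k).eval z.2 * z.1 ^ k := by
    ext z
    rw [← evalXY_eq_sum, ← h]
  rw [hfun]
  refine ContDiff.sum fun k _ => ContDiff.mul ?_ (contDiff_fst.pow k)
  have hc : ContDiff ℝ 1 fun y => (p.coeff k).eval y := by
    simpa using (p.coeff k).contDiff_aeval (𝕜 := ℝ) 1
  exact hc.comp contDiff_snd

theorem IsBiPoly.section_fst {r : ℕ} {f : ℝ × ℝ → ℝ} (hf : IsBiPoly r f) (y : ℝ) :
    ∃ p : ℝ[X], p.natDegree ≤ r ∧ ∀ x, f (x, y) = p.eval x := by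
  obtain ⟨p, hp, -, h⟩ := hf
  exact ⟨p.map (evalRingHom y), natDegree_map_le.trans hp, fun x => h x y⟩

theorem IsBiPoly.section_snd {r : ℕ} {f : ℝ × ℝ → ℝ} (hf : IsBiPoly r f) (x : ℝ) :
    ∃ p : ℝ[X], p.natDegree ≤ r ∧ ∀ y, f (x, y) = p.eval y := by
  obtain ⟨p, -, hp, h⟩ := hf
  refine ⟨∑ k ∈ Finset.range (p.natDegree + 1), p.coeff k * C (x ^ k), ?_, fun y => ?_⟩
  · exact natDegree_sum_le_of_forall_le _ _ fun k _ => (natDegree_mul_C_le _ _).trans (hp k)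
  · rw [h, evalXY_eq_sum, eval_finsetSum]
    simp

/-- The contribution of the set `Q` to the broken seminorm of order `s`. -/
noncomputable def setSemi (Q : Set (ℝ × ℝ)) (f : ℝ × ℝ → ℝ) (s : ℕ) : ℝ :=
  √(∑ t ∈ Finset.range (s + 1), ∫ z in Q, (pdx^[t] (pdy^[s - t] f) z) ^ 2)

theorem setSemi_nonneg (Q : Set (ℝ × ℝ)) (f : ℝ × ℝ → ℝ) (s : ℕ) : 0 ≤ setSemi Q f s :=
  Real.sqrt_nonneg _

theorem sqrt_integral_sq_le_setSemi (Q : Set (ℝ × ℝ)) (f : ℝ × ℝ → ℝ) {s t : ℕ} (ht : t ≤ s) :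
    √(∫ z in Q, (pdx^[t] (pdy^[s - t] f) z) ^ 2) ≤ setSemi Q f s :=
  Real.sqrt_le_sqrt (Finset.single_le_sum
    (f := fun t => ∫ z in Q, (pdx^[t] (pdy^[s - t] f) z) ^ 2)
    (fun _ _ => integral_nonneg fun _ => sq_nonneg _) (Finset.mem_range.2 (by omega)))

theorem brokenSemi_eq {a b c d : ℝ} (P : RectPartition a b c d) (u : PiecewiseFun P) (s : ℕ) :
    brokenSemi P u s = √(∑ i ∈ Finset.Icc 1 P.m, ∑ j ∈ Finset.Icc 1 P.n,
      setSemi (P.cell i j) (u.cellFun i j) s ^ 2) := by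
  have h : ∀ i j, setSemi (P.cell i j) (u.cellFun i j) s ^ 2 = ∑ t ∈ Finset.range (s + 1),
      ∫ z in P.cell i j, (pdx^[t] (pdy^[s - t] (u.cellFun i j)) z) ^ 2 := fun i j =>
    Real.sq_sqrt (Finset.sum_nonneg fun _ _ => integral_nonneg fun _ => sq_nonneg _)
  simp only [brokenSemi, h]

theorem pow_mul_add_div_mul_le {r : ℕ} {K σ h δ η S I J : ℝ} (hK : 0 ≤ K) (hδ : 0 < δ)
    (hη : 0 ≤ η) (hδh : δ ≤ h) (hηh : η ≤ h) (hσ : h ≤ σ * δ) (hS : 0 ≤ S) (hI : I ≤ h * S)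
    (hJ : J ≤ h * S) :
    δ ^ r * I + K / δ * η ^ (r + 1) * J ≤ (1 + K * σ) * h ^ (r + 1) * S := by
  have hh : 0 < h := hδ.trans_le hδh
  have h1 : δ ^ r * I ≤ h ^ r * (h * S) := by
    refine (mul_le_mul_of_nonneg_left hI (by positivity)).trans ?_
    gcongr
  have h2 : K / δ * η ^ (r + 1) * J ≤ K / δ * h ^ (r + 1) * (h * S) := by
    refine (mul_le_mul_of_nonneg_left hJ (by positivity)).trans ?_
    gcongr
  have h3 : K / δ * h ^ (r + 1) * (h * S) ≤ K / δ * h ^ (r + 1) * (σ * δ * S) := by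
    gcongr
  have h4 : K / δ * h ^ (r + 1) * (σ * δ * S) = K * σ * h ^ (r + 1) * S := by
    field_simp
  calc _ ≤ h ^ r * (h * S) + K * σ * h ^ (r + 1) * S := by linarith
    _ = _ := by ring

/-- On each cell, the normal derivative of the Lobatto interpolation error is superconvergent
along the Gauss lines in either direction. -/
theorem exists_cell_gauss_line_bound {r : ℕ} (hr : 1 ≤ r) {G L : ℕ → ℝ}
    (hG : IsGaussPoints r G) (hL : IsLobattoPoints r L) :
    ∃ K : ℝ, 0 ≤ K ∧ ∀ x₀ x₁ y₀ y₁ h σ : ℝ, x₀ < x₁ → y₀ < y₁ → x₁ - x₀ ≤ h → y₁ - y₀ ≤ h →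
      h ≤ σ * (x₁ - x₀) → h ≤ σ * (y₁ - y₀) → ∀ f v : ℝ × ℝ → ℝ,
      ContDiff ℝ (r + 2 : ℕ) f → IsBiPoly r v →
      (∀ k ≤ r, ∀ l ≤ r,
        v ((x₀ + x₁ + (x₁ - x₀) * L k) / 2, (y₀ + y₁ + (y₁ - y₀) * L l) / 2) =
        f ((x₀ + x₁ + (x₁ - x₀) * L k) / 2, (y₀ + y₁ + (y₁ - y₀) * L l) / 2)) →
      ∀ k ∈ Finset.Icc 1 r,
        (∫ t in y₀..y₁, |pdx (fun z => f z - v z) ((x₀ + x₁ + (x₁ - x₀) * G k) / 2, t)| ≤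
          (1 + K * σ) * h ^ (r + 1) * setSemi (Set.Icc x₀ x₁ ×ˢ Set.Icc y₀ y₁) f (r + 2)) ∧
        ∫ t in x₀..x₁, |pdy (fun z => f z - v z) (t, (y₀ + y₁ + (y₁ - y₀) * G k) / 2)| ≤
          (1 + K * σ) * h ^ (r + 1) * setSemi (Set.Icc x₀ x₁ ×ˢ Set.Icc y₀ y₁) f (r + 2) := by
  obtain ⟨K, hK, hbound⟩ := exists_gauss_line_bound hr hG hL
  refine ⟨K, hK, fun x₀ x₁ y₀ y₁ h σ hx hy hxh hyh hσx hσy f v hf hv hnode k hk => ?_⟩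
  set Q := Set.Icc x₀ x₁ ×ˢ Set.Icc y₀ y₁
  have hh : 0 ≤ h := by linarith
  have hf' : ContDiff ℝ (0 + (r + 2) : ℕ) f := by simpa only [Nat.zero_add] using hf
  have hcomponent : ∀ t ≤ r + 2, ∀ F : ℝ × ℝ → ℝ, ContDiff ℝ (0 : ℕ) F →
      F = pdx^[t] (pdy^[r + 2 - t] f) →
      (∫ x in x₀..x₁, ∫ y in y₀..y₁, |F (x, y)|) ≤ h * setSemi Q f (r + 2) := by
    rintro t ht F hF rfl
    exact (integral_integral_abs_le hF.continuous hx.le hy.le hxh hyh).trans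
      (mul_le_mul_of_nonneg_left (sqrt_integral_sq_le_setSemi Q f ht) hh)
  have hxx : ContDiff ℝ (0 : ℕ) (pdx^[r + 2] f) := contDiff_iterate_pdx _ hf'
  have hyy : ContDiff ℝ (0 : ℕ) (pdy^[r + 2] f) := contDiff_iterate_pdy _ hf'
  have hxy : ContDiff ℝ (0 : ℕ) (pdx (pdy^[r + 1] f)) :=
    contDiff_pdx (contDiff_iterate_pdy _ (hf.of_le (by exact_mod_cast (by omega))))
  have hyx : ContDiff ℝ (0 : ℕ) (pdy (pdx^[r + 1] f)) :=
    contDiff_pdy (contDiff_iterate_pdx _ (hf.of_le (by exact_mod_cast (by omega))))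
  constructor
  · refine (hbound x₀ x₁ y₀ y₁ hx hy f v hf hv.contDiff hv.section_fst hv.section_snd hnode k
      hk).trans (pow_mul_add_div_mul_le hK (sub_pos.2 hx) (sub_pos.2 hy).le hxh hyh hσx
        (setSemi_nonneg _ _ _) ?_ ?_)
    · rw [integral_integral_abs_swap hxx.continuous]
      exact hcomponent (r + 2) le_rfl _ hxx (by simp)
    · rw [integral_integral_abs_swap hxy.continuous]
      exact hcomponent 1 (by omega) _ hxy rfl
  · have hsub : (fun z => (f ∘ Prod.swap) z - (v ∘ Prod.swap) z) =
        (fun z => f z - v z) ∘ Prod.swap := rfl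
    have hline := hbound y₀ y₁ x₀ x₁ hy hx (f ∘ Prod.swap) (v ∘ Prod.swap)
      (hf.comp (contDiff_snd.prodMk contDiff_fst))
      (hv.contDiff.comp (contDiff_snd.prodMk contDiff_fst)) hv.section_snd hv.section_fst
      (fun k hk l hl => hnode l hl k hk) k hk
    rw [hsub, pdx_comp_swap, iterate_pdx_comp_swap, iterate_pdy_comp_swap, pdx_comp_swap] at hline
    refine hline.trans (pow_mul_add_div_mul_le hK (sub_pos.2 hy) (sub_pos.2 hx).le hyh hxh hσy
        (setSemi_nonneg _ _ _) ?_ ?_)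
    · exact hcomponent 0 (by omega) _ hyy rfl
    · refine hcomponent (r + 1) (by omega) _ hyx ?_
      rw [pdy_iterate_pdx_comm _ (hf.of_le (by exact_mod_cast (by omega)))]
      simp [show r + 2 - (r + 1) = 1 by omega]

theorem lobattoNode_mem_cell {a b c d : ℝ} (P : RectPartition a b c d) {r : ℕ} {L : ℕ → ℝ}
    (hL : IsLobattoPoints r L) {i j k l : ℕ} (hi : i ∈ Finset.Icc 1 P.m)
    (hj : j ∈ Finset.Icc 1 P.n) (hk : k ≤ r) (hl : l ≤ r) :
    lobattoNode P L i j k l ∈ P.cell i j :=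
  ⟨affine_mem_Icc (P.x_pred_lt hi).le (lobatto_mem_Icc hL hk),
    affine_mem_Icc (P.y_pred_lt hj).le (lobatto_mem_Icc hL hl)⟩

/-- Weak superconvergence of the Lobatto interpolant: there is `C = C(r, σ) > 0`
such that for every `σ`-quasi-uniform partition with mesh size `h`, every
bounded measurable `α`, every `u` continuous, vanishing on `∂Ω` and cellwise
`C^{r+2}`, and every test function `w`,
`|a_P(u − u_I, w)| ≤ C (sup|α|) h^{r+1} |u|_{r+2,P} |w|_{P'}`. -/
theorem fvm_interpolant_superapproximation (r : ℕ) (hr : 1 ≤ r) (G : ℕ → ℝ)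
    (hG : IsGaussPoints r G) (L : ℕ → ℝ) (hL : IsLobattoPoints r L)
    (σ : ℝ) (hσ : 1 ≤ σ) :
    ∃ C : ℝ, 0 < C ∧
      ∀ (a b c d : ℝ), a < b → c < d →
      ∀ P : RectPartition a b c d, P.QuasiUniform σ →
      ∀ α : ℝ × ℝ → ℝ, Measurable α →
      ∀ αM : ℝ, (∀ z ∈ P.dom, |α z| ≤ αM) →
      ∀ u : PiecewiseFun P, ContinuousOn u.toFun P.dom →
        (∀ z ∈ P.bdry, u.toFun z = 0) → CellSmooth P (r + 2) u →
      ∀ uI : PiecewiseFun P, IsLobattoInterp r L P u.toFun uI →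
      ∀ w : ℕ → ℕ → ℕ → ℕ → ℝ, IsTestFun r P w →
        |aP r G P α (cellDx (u.sub uI)) (cellDy (u.sub uI)) w| ≤
          C * αM * P.meshSize ^ (r + 1) * brokenSemi P u (r + 2) * dualSemi r P w := by
  obtain ⟨K, hK, hbound⟩ := exists_cell_gauss_line_bound hr hG hL
  have hr0 : (0 : ℝ) < r := by exact_mod_cast hr
  have hσ0 : 0 < σ := by linarith
  refine ⟨4 * r * (1 + K * σ), by positivity, ?_⟩
  intro a b c d hab hcd P hP α _ αM hα u _ _ hu uI huI w _
  have hαM : 0 ≤ αM := (abs_nonneg _).trans (hα (a, c) ⟨⟨le_rfl, hab.le⟩, ⟨le_rfl, hcd.le⟩⟩)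
  have hmesh : 0 ≤ P.meshSize :=
    (sub_pos.2 (P.x_pred_lt (Finset.mem_Icc.2 ⟨le_rfl, P.hm⟩))).le.trans
      (P.hx_le_meshSize (Finset.mem_Icc.2 ⟨le_rfl, P.hm⟩))
  set S : ℕ → ℕ → ℝ := fun i j => setSemi (P.cell i j) (u.cellFun i j) (r + 2) with hS
  set B : ℝ := (1 + K * σ) * P.meshSize ^ (r + 1) with hB
  have hαB : 0 ≤ αM * B := by positivity
  have hline : ∀ i ∈ Finset.Icc 1 P.m, ∀ j ∈ Finset.Icc 1 P.n, ∀ k ∈ Finset.Icc 1 r,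
      (∫ t in (P.y (j - 1))..(P.y j), |cellDx (u.sub uI) i j (P.gx r G i k, t)| ≤ B * S i j) ∧
      ∫ t in (P.x (i - 1))..(P.x i), |cellDy (u.sub uI) i j (t, P.gy r G j k)| ≤ B * S i j := by
    intro i hi j hj k hk
    have hk' := (Finset.mem_Icc.1 hk).2
    have hgy : P.gy r G j k = (P.y (j - 1) + P.y j + (P.y j - P.y (j - 1)) * G k) / 2 :=
      P.swap.gx_eq r G j hk'
    rw [P.gx_eq r G i hk', hgy]
    refine hbound _ _ _ _ P.meshSize σ (P.x_pred_lt hi) (P.y_pred_lt hj) (P.hx_le_meshSize hi)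
      (P.hy_le_meshSize hj) (P.meshSize_le_mul_hx hP hi) (P.meshSize_le_mul_hy hP hj)
      (u.cellFun i j) (uI.cellFun i j) (hu i hi j hj) (huI.1.2.2 i hi j hj) ?_ k hk
    intro k hk l hl
    have hmem := lobattoNode_mem_cell P hL hi hj hk hl
    exact (uI.agree i hi j hj _ hmem).trans ((huI.2 i hi j hj k (by simpa using hk) l
      (by simpa using hl)).trans (u.agree i hi j hj _ hmem).symm)
  have herr : ∀ i ∈ Finset.Icc 1 P.m, ∀ j ∈ Finset.Icc 1 P.n,
      ContDiff ℝ (0 + 1 : ℕ) ((u.sub uI).cellFun i j) := fun i hi j hj =>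
    ((hu i hi j hj).of_le (by exact_mod_cast (by omega))).sub
      (by simpa using (huI.1.2.2 i hi j hj).contDiff)
  have hX := P.abs_sum_idxX_le hr hG hα (D := cellDx (u.sub uI))
    (fun i hi j hj => (contDiff_pdx (herr i hi j hj)).continuous) hαB
    (fun i hi j hj k hk => (hline i hi j hj k hk).1) w
  have hY := P.swap.abs_sum_idxX_le hr hG (α := α ∘ Prod.swap) (αM := αM)
    (fun z hz => hα z.swap ⟨hz.2, hz.1⟩) (D := fun j i z => cellDy (u.sub uI) i j z.swap)
    (fun j hj i hi => (contDiff_pdy (herr i hi j hj)).continuous.comp continuous_swap) hαB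
    (S := fun j i => S i j)
    (fun j hj i hi k hk => (hline i hi j hj k hk).2) (fun j l i k => w i k j l)
  simp only [jumpX_swap] at hY
  rw [← P.sum_idxY_eq r fun i k j l => jumpY r w i k j l ^ 2, Finset.sum_comm] at hY
  have hYsum := P.sum_idxY_eq r fun i k j l => jumpY r w i k j l *
      ((∫ t in (P.gx r G i k)..(min (P.gx r G i (k + 1)) (P.x i)),
          α (t, P.gy r G j l) * cellDy (u.sub uI) i j (t, P.gy r G j l)) +
       (∫ t in (P.x i)..(max (P.gx r G i (k + 1)) (P.x i)),
          α (t, P.gy r G j l) * cellDy (u.sub uI) (i + 1) j (t, P.gy r G j l)))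
  have hJX : √(∑ q ∈ idxX r P, jumpX r w q.1 q.2.1 q.2.2.1 q.2.2.2 ^ 2) ≤ dualSemi r P w :=
    Real.sqrt_le_sqrt (le_add_of_nonneg_right (Finset.sum_nonneg fun _ _ => sq_nonneg _))
  have hJY : √(∑ q ∈ idxY r P, jumpY r w q.1 q.2.1 q.2.2.1 q.2.2.2 ^ 2) ≤ dualSemi r P w :=
    Real.sqrt_le_sqrt (le_add_of_nonneg_left (Finset.sum_nonneg fun _ _ => sq_nonneg _))
  have hsemi : 0 ≤ 2 * r * brokenSemi P u (r + 2) := by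
    have := Real.sqrt_nonneg (∑ i ∈ Finset.Icc 1 P.m, ∑ j ∈ Finset.Icc 1 P.n, S i j ^ 2)
    rw [brokenSemi_eq]
    positivity
  have hX' := hX.trans (mul_le_mul_of_nonneg_left
    (mul_le_mul_of_nonneg_right hJX (by rw [← brokenSemi_eq]; exact hsemi)) hαB)
  have hY' := hY.trans (mul_le_mul_of_nonneg_left
    (mul_le_mul_of_nonneg_right hJY (by erw [← brokenSemi_eq]; exact hsemi)) hαB)
  rw [aP, hYsum]
  refine (abs_add_le _ _).trans ((add_le_add hX' hY').trans (le_of_eq ?_))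
  rw [brokenSemi_eq]
  simp only [hB, hS, RectPartition.swap]
  ring
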